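/- Let M be a C² d-dimensional submanifold of ℝ^N with reach R, let 0 < ρ < R, let x ∈ M with unit normal vector v ∈ N_x M, and let 0 ≤ τ ≤ ρ. Let Π be a d-dimensional affine subspace through y = x + τv with ∠(Π, T_x M) < π/2. Then the restriction of π_M to a sufficiently small open neighborhood of y in Π is a C¹-diffeomorphism onto its image in M; moreover the Jacobian determinant of the derivative at y (expressed in normal coordinates using the chart ξ⁻¹ ∘ π_M, where the shape operator in direction v is II_v) lies in the interval [ (R/(R+ρ))^d · (cos ∠(Π, T_x M))^{min(d, N-d)}, (R/(R-ρ))^d · cos ∠(Π, T_x M) ]. -/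

import Mathlib

open scoped Classical
open Metric Set Module

/-- A point `x` has a unique nearest point in `M`. -/
def HasUniqueNearest {N : ℕ} (M : Set (EuclideanSpace ℝ (Fin N)))
    (x : EuclideanSpace ℝ (Fin N)) : Prop :=
  ∃! m, m ∈ M ∧ dist x m = Metric.infDist x M

/-- The reach of a set `M ⊆ ℝ^N`. -/
noncomputable def reach {N : ℕ} (M : Set (EuclideanSpace ℝ (Fin N))) : ENNReal :=
  ⨆ (r : NNReal) (_ : ∀ x, Metric.infDist x M < r → HasUniqueNearest M x), (r : ENNReal)

/-- A nearest point of `M` to `x` (the nearest-point projection `π_M`). -/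
noncomputable def nearestPt {N : ℕ} (M : Set (EuclideanSpace ℝ (Fin N)))
    (x : EuclideanSpace ℝ (Fin N)) : EuclideanSpace ℝ (Fin N) :=
  if h : ∃ m ∈ M, dist x m = Metric.infDist x M then h.choose else x

/-- `M` is a `d`-dimensional `C²` submanifold of `ℝ^N`. -/
def IsC2Submanifold {N : ℕ} (d : ℕ) (M : Set (EuclideanSpace ℝ (Fin N))) : Prop :=
  ∀ x ∈ M, ∃ (U : Set (EuclideanSpace ℝ (Fin d)))
      (ξ : EuclideanSpace ℝ (Fin d) → EuclideanSpace ℝ (Fin N))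
      (V : Set (EuclideanSpace ℝ (Fin N))),
    IsOpen U ∧ IsOpen V ∧ x ∈ V ∧ ContDiffOn ℝ 2 ξ U ∧ Set.InjOn ξ U ∧
    ξ '' U = M ∩ V ∧
    (∀ u ∈ U, Function.Injective (fderivWithin ℝ ξ U u)) ∧
    ContinuousOn (Function.invFunOn ξ U) (M ∩ V)

/-- The tangent space of `M` at `m`, as the span of the tangent cone. -/
noncomputable def tangentSpan {N : ℕ} (M : Set (EuclideanSpace ℝ (Fin N)))
    (m : EuclideanSpace ℝ (Fin N)) : Submodule ℝ (EuclideanSpace ℝ (Fin N)) :=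
  Submodule.span ℝ (tangentConeAt ℝ M m)

/-- The angle between two subspaces of an inner product space. -/
noncomputable def subspaceAngle {E : Type*} [NormedAddCommGroup E] [InnerProductSpace ℝ E]
    (V₀ V₁ : Submodule ℝ E) : ℝ :=
  sSup {θ : ℝ | ∃ v₀ ∈ V₀, v₀ ≠ 0 ∧
    θ = sInf {φ : ℝ | ∃ v₁ ∈ V₁, v₁ ≠ 0 ∧ φ = InnerProductGeometry.angle v₀ v₁}}

open Filter Topology in
theorem uniq_of_reach {N : ℕ} (M : Set (EuclideanSpace ℝ (Fin N))) (R : ℝ)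
    (hreach : ENNReal.ofReal R = reach M) (p : EuclideanSpace ℝ (Fin N))
    (hp : Metric.infDist p M < R) : HasUniqueNearest M p := by
  have h0 : 0 ≤ Metric.infDist p M := Metric.infDist_nonneg
  have h1 : ENNReal.ofReal (Metric.infDist p M) < reach M := by
    rw [← hreach]
    exact (ENNReal.ofReal_lt_ofReal_iff (lt_of_le_of_lt h0 hp)).2 hp
  unfold reach at h1
  obtain ⟨r, hr⟩ := lt_iSup_iff.1 h1
  obtain ⟨hr1, hr2⟩ := lt_iSup_iff.1 hr
  apply hr1
  rw [ENNReal.ofReal_lt_iff_lt_toReal h0 (by simp)] at hr2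
  simpa using hr2

theorem nearestPt_spec {N : ℕ} (M : Set (EuclideanSpace ℝ (Fin N))) (hMc : IsCompact M)
    (hMne : M.Nonempty) (p : EuclideanSpace ℝ (Fin N)) :
    nearestPt M p ∈ M ∧ dist p (nearestPt M p) = Metric.infDist p M := by
  have h : ∃ m ∈ M, dist p m = Metric.infDist p M := by
    obtain ⟨m, hm, h⟩ := hMc.exists_infDist_eq_dist hMne p
    exact ⟨m, hm, h.symm⟩
  unfold nearestPt
  rw [dif_pos h]
  exact h.choose_spec

open Filter Topology in
theorem nearestPt_continuousAt {N : ℕ} (M : Set (EuclideanSpace ℝ (Fin N))) (hMc : IsCompact M)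
    (hMne : M.Nonempty) (p : EuclideanSpace ℝ (Fin N)) (hp : HasUniqueNearest M p) :
    ContinuousAt (nearestPt M) p := by
  apply hMc.tendsto_nhds_of_unique_mapClusterPt
  · exact Eventually.of_forall fun q => (nearestPt_spec M hMc hMne q).1
  · intro m hm hcl
    obtain ⟨m₀, -, huniq⟩ := hp
    have hs := nearestPt_spec M hMc hMne p
    rw [huniq m ⟨hm, ?_⟩, huniq _ hs]
    have hc : MapClusterPt (dist p m - Metric.infDist p M) (𝓝 p)
        (fun q => dist q (nearestPt M q) - Metric.infDist q M + (dist p (nearestPt M q) - dist q (nearestPt M q)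
          - Metric.infDist p M + Metric.infDist q M)) := by
      have := hcl.continuousAt_comp (f := fun z => dist p z - Metric.infDist p M)
        (by fun_prop)
      refine this.congrFun ?_
      exact Eventually.of_forall fun q => by simp only [Function.comp]; ring
    have ht : Tendsto (fun q => dist q (nearestPt M q) - Metric.infDist q M + (dist p (nearestPt M q) - dist q (nearestPt M q)
          - Metric.infDist p M + Metric.infDist q M)) (𝓝 p) (𝓝 0) := by
      have h1 : Tendsto (fun q => 2 * dist p q) (𝓝 p) (𝓝 0) := by
        have : Continuous (fun q => 2 * dist p q) := by fun_prop
        simpa using this.tendsto p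
      apply squeeze_zero_norm (fun q => ?_) h1
      rw [(nearestPt_spec M hMc hMne q).2]
      have a1 := Metric.infDist_le_infDist_add_dist (s := M) (x := p) (y := q)
      have a2 := Metric.infDist_le_infDist_add_dist (s := M) (x := q) (y := p)
      have a3 := dist_triangle p q (nearestPt M q)
      have a4 := dist_triangle q p (nearestPt M q)
      rw [(nearestPt_spec M hMc hMne q).2] at a3 a4
      rw [dist_comm q p] at *
      rw [Real.norm_eq_abs, abs_le]
      constructor <;> linarith
    have : dist p m - Metric.infDist p M = 0 := eq_of_nhds_neBot (ClusterPt.mono hc ht)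
    linarith

open Filter Topology in
/-- slope one ascent of the distance function -/
theorem ascent {N : ℕ} (M : Set (EuclideanSpace ℝ (Fin N))) (hMc : IsCompact M)
    (hMne : M.Nonempty) (z : EuclideanSpace ℝ (Fin N)) (hz : HasUniqueNearest M z)
    (hpos : 0 < Metric.infDist z M) (c : ℝ) (hc1 : c < 1) (hc0 : 0 < c) (r : ℝ) (hr : 0 < r) :
    ∃ z', z' ≠ z ∧ dist z' z < r ∧
      Metric.infDist z M + c * dist z' z ≤ Metric.infDist z' M := by
  set δ := Metric.infDist z M with hδ
  set m := nearestPt M z with hm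
  have hsp := nearestPt_spec M hMc hMne z
  have hnorm : ‖z - m‖ = δ := by rw [← dist_eq_norm]; exact hsp.2
  set n := δ⁻¹ • (z - m) with hn
  have hn1 : ‖n‖ = 1 := by
    rw [hn, norm_smul, hnorm, norm_inv, Real.norm_eq_abs, abs_of_pos hpos]
    field_simp
  have hcont := nearestPt_continuousAt M hMc hMne z hz
  have hlin : Tendsto (fun h : ℝ => z + h • n) (𝓝 0) (𝓝 z) := by
    have : Continuous (fun h : ℝ => z + h • n) := by fun_prop
    simpa using this.tendsto 0
  have hcomp : Tendsto (fun h : ℝ => inner ℝ n (z - nearestPt M (z + h • n))) (𝓝 0)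
      (𝓝 (inner ℝ n (z - m))) := by
    have h1 : Tendsto (fun h : ℝ => nearestPt M (z + h • n)) (𝓝 0) (𝓝 m) := hcont.tendsto.comp hlin
    exact tendsto_const_nhds.inner (tendsto_const_nhds.sub h1)
  have hin : inner ℝ n (z - m) = δ := by
    rw [hn, real_inner_smul_left, real_inner_self_eq_norm_sq, hnorm]
    field_simp
  rw [hin] at hcomp
  have hev : ∀ᶠ h : ℝ in 𝓝 0, c * δ < inner ℝ n (z - nearestPt M (z + h • n)) :=
    hcomp.eventually_const_lt (by nlinarith)
  obtain ⟨ε, hε, hball⟩ := Metric.eventually_nhds_iff.1 hev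
  set h := min ε r / 2 with hh
  have hhp : 0 < h := by positivity
  have hh1 : h < ε := by have := min_le_left ε r; linarith [lt_min hε hr]
  have hh2 : h < r := by have := min_le_right ε r; linarith [lt_min hε hr]
  have hb := hball (y := h) (by simpa [abs_of_pos hhp] using hh1)
  have hd : dist (z + h • n) z = h := by
    rw [dist_eq_norm]; simp [norm_smul, hn1, abs_of_pos hhp]
  refine ⟨z + h • n, ?_, by rw [hd]; exact hh2, ?_⟩
  · intro he; rw [he] at hd; simp at hd; linarith
  · rw [hd]
    set m' := nearestPt M (z + h • n) with hm'
    have hs' := nearestPt_spec M hMc hMne (z + h • n)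
    rw [← hs'.2, dist_eq_norm]
    refine (pow_le_pow_iff_left₀ (by positivity) (norm_nonneg _) two_ne_zero).1 ?_
    have e : z + h • n - m' = (z - m') + h • n := by abel
    rw [← hm', e, norm_add_sq_real, real_inner_smul_right, real_inner_comm, norm_smul, hn1,
      Real.norm_eq_abs, abs_of_pos hhp]
    have hδle : δ ≤ ‖z - m'‖ := by
      rw [← dist_eq_norm]; exact Metric.infDist_le_dist_of_mem hs'.1
    have q1 : δ ^ 2 ≤ ‖z - m'‖ ^ 2 := pow_le_pow_left₀ hpos.le hδle 2
    have q2 : (c * h) ^ 2 ≤ h ^ 2 := pow_le_pow_left₀ (by positivity) (by nlinarith) 2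
    have q3 := mul_lt_mul_of_pos_left hb hhp
    nlinarith

open Filter Topology in
theorem ascent_sphere {N : ℕ} (M : Set (EuclideanSpace ℝ (Fin N))) (hMc : IsCompact M)
    (hMne : M.Nonempty) (R : ℝ) (hu : ∀ p, Metric.infDist p M < R → HasUniqueNearest M p)
    (p : EuclideanSpace ℝ (Fin N)) (s : ℝ) (hs0 : 0 < s) (hs1 : s < Metric.infDist p M)
    (hs2 : Metric.infDist p M + s < R) :
    ∃ q, dist q p ≤ s ∧ Metric.infDist p M + s ≤ Metric.infDist q M := by
  have key : ∀ c : ℝ, 0 < c → c < 1 → ∃ q, dist q p ≤ s ∧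
      Metric.infDist p M + c * s ≤ Metric.infDist q M := by
    intro c hc0 hc1
    have hcpt : IsCompact (Metric.closedBall p s) := isCompact_closedBall p s
    obtain ⟨z, hz, hmax⟩ := hcpt.exists_isMaxOn (f := fun z => Metric.infDist z M - c * dist z p)
      ⟨p, Metric.mem_closedBall_self hs0.le⟩
      (((Metric.continuous_infDist_pt M).sub (by fun_prop)).continuousOn)
    have hmax' : ∀ z' , dist z' p ≤ s → Metric.infDist z' M - c * dist z' p ≤
        Metric.infDist z M - c * dist z p := fun z' hz' => hmax (Metric.mem_closedBall.2 hz')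
    have hzs : dist z p ≤ s := hz
    by_cases hlt : dist z p < s
    · exfalso
      have a1 := Metric.infDist_le_infDist_add_dist (s := M) (x := z) (y := p)
      have a2 := Metric.infDist_le_infDist_add_dist (s := M) (x := p) (y := z)
      rw [dist_comm p z] at a2
      obtain ⟨z', hne, hd, hinc⟩ := ascent M hMc hMne z (hu z (by linarith)) (by linarith)
        ((1 + c)/2) (by linarith) (by linarith) (s - dist z p) (by linarith)
      have tri := dist_triangle z' z p
      have := hmax' z' (by linarith)
      have hpos : 0 < dist z' z := dist_pos.2 hne
      nlinarith
    · have he : dist z p = s := le_antisymm hzs (not_lt.1 hlt)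
      refine ⟨z, hzs, ?_⟩
      have := hmax' p (by simpa using hs0.le)
      rw [he] at this
      simp at this
      linarith
  obtain ⟨q, hq, hqm⟩ := (isCompact_closedBall p s).exists_isMaxOn (f := fun z => Metric.infDist z M)
      ⟨p, Metric.mem_closedBall_self hs0.le⟩
      ((Metric.continuous_infDist_pt M).continuousOn)
  refine ⟨q, hq, ?_⟩
  have hall : ∀ c : ℝ, 0 < c → c < 1 → Metric.infDist p M + c * s ≤ Metric.infDist q M := by
    intro c h0 h1
    obtain ⟨q', h, h'⟩ := key c h0 h1
    exact h'.trans (hqm (Metric.mem_closedBall.2 h))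
  by_contra hcon
  push Not at hcon
  have h2 := hall (1/2) (by norm_num) (by norm_num)
  set g := Metric.infDist p M + s - Metric.infDist q M with hg
  have hgp : 0 < g := by linarith
  have := hall (1 - g / (2 * s)) (by
    rw [sub_pos, div_lt_one (by positivity)]; linarith) (by
    have : 0 < g / (2*s) := by positivity
    linarith)
  have e : (1 - g / (2 * s)) * s = s - g / 2 := by field_simp
  rw [e] at this
  linarith

open Filter Topology in
theorem extend_step {N : ℕ} (M : Set (EuclideanSpace ℝ (Fin N))) (hMc : IsCompact M)
    (hMne : M.Nonempty) (R : ℝ) (hu : ∀ p, Metric.infDist p M < R → HasUniqueNearest M p)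
    (x v : EuclideanSpace ℝ (Fin N)) (hx : x ∈ M) (hv : ‖v‖ = 1) (t s : ℝ)
    (ht : Metric.infDist (x + t • v) M = t) (hs0 : 0 < s) (hst : s < t) (hR : t + s < R) :
    Metric.infDist (x + (t + s) • v) M = t + s := by
  obtain ⟨q, hq, hq'⟩ := ascent_sphere M hMc hMne R hu (x + t • v) s hs0 (by rw [ht]; exact hst)
    (by rw [ht]; exact hR)
  rw [ht] at hq'
  have h1 : Metric.infDist q M ≤ dist q x := Metric.infDist_le_dist_of_mem hx
  -- a := q - (x + t v), b := t v
  set a := q - (x + t • v) with ha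
  have hna : ‖a‖ ≤ s := by rw [ha, ← dist_eq_norm]; exact hq
  have hqx : q - x = a + t • v := by rw [ha]; abel
  rw [dist_eq_norm, hqx] at h1
  have hsq : (t + s)^2 ≤ ‖a + t • v‖^2 := by
    apply pow_le_pow_left₀ (by linarith) (by linarith)
  rw [norm_add_sq_real, real_inner_smul_right, norm_smul, hv, Real.norm_eq_abs,
    abs_of_pos (hs0.trans hst)] at hsq
  have hz : ‖a - s • v‖^2 ≤ 0 := by
    rw [norm_sub_sq_real, real_inner_smul_right, norm_smul, hv, Real.norm_eq_abs, abs_of_pos hs0]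
    have h3 : ‖a‖^2 ≤ s^2 := pow_le_pow_left₀ (norm_nonneg _) hna 2
    have h4 : s ≤ inner ℝ a v := by
      have : 0 < t := hs0.trans hst
      nlinarith
    nlinarith
  have hz' : a - s • v = 0 := by
    rw [← norm_eq_zero]
    nlinarith [norm_nonneg (a - s • v)]
  have hqe : q = x + (t + s) • v := by
    have : q = a + (x + t • v) := by rw [ha]; abel
    rw [this, sub_eq_zero.1 hz', add_smul]; abel
  rw [← hqe]
  refine le_antisymm ?_ hq'
  refine (Metric.infDist_le_dist_of_mem hx).trans ?_
  rw [dist_eq_norm, hqe]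
  simp [norm_smul, hv, abs_of_pos (show 0 < t + s by linarith)]

theorem shorter {N : ℕ} (M : Set (EuclideanSpace ℝ (Fin N)))
    (x v : EuclideanSpace ℝ (Fin N)) (hx : x ∈ M) (hv : ‖v‖ = 1) (t s : ℝ)
    (ht : Metric.infDist (x + t • v) M = t) (hs0 : 0 ≤ s) (hst : s ≤ t) :
    Metric.infDist (x + s • v) M = s := by
  have h1 := Metric.infDist_le_infDist_add_dist (s := M) (x := x + t • v) (y := x + s • v)
  have h2 := Metric.infDist_le_dist_of_mem (x := x + s • v) hx
  have e1 : dist (x + t • v) (x + s • v) = t - s := by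
    rw [dist_eq_norm, add_sub_add_left_eq_sub, ← sub_smul, norm_smul, hv, Real.norm_eq_abs,
      abs_of_nonneg (by linarith), mul_one]
  have e2 : dist (x + s • v) x = s := by
    rw [dist_eq_norm]; simp [norm_smul, hv, abs_of_nonneg hs0]
  rw [e1] at h1
  rw [e2] at h2
  linarith

open Filter Topology in
theorem normal_ray {N : ℕ} (M : Set (EuclideanSpace ℝ (Fin N))) (hMc : IsCompact M)
    (hMne : M.Nonempty) (R : ℝ) (hu : ∀ p, Metric.infDist p M < R → HasUniqueNearest M p)
    (x v : EuclideanSpace ℝ (Fin N)) (hx : x ∈ M) (hv : ‖v‖ = 1) (t₀ : ℝ) (ht₀ : 0 < t₀)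
    (ht : Metric.infDist (x + t₀ • v) M = t₀) (t : ℝ) (h0 : 0 ≤ t) (hR : t < R) :
    Metric.infDist (x + t • v) M = t := by
  by_cases hle : t ≤ t₀
  · exact shorter M x v hx hv t₀ t ht h0 hle
  push Not at hle
  set A : Set ℝ := {s | s ∈ Set.Icc t₀ t ∧ Metric.infDist (x + s • v) M = s} with hA
  have hcl : IsClosed A := by
    apply isClosed_Icc.inter
    exact isClosed_eq ((Metric.continuous_infDist_pt M).comp (by fun_prop)) continuous_id
  have hbdd : BddAbove A := ⟨t, fun s hs => hs.1.2⟩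
  have hne : A.Nonempty := ⟨t₀, ⟨le_rfl, hle.le⟩, ht⟩
  have hmem := hcl.csSup_mem hne hbdd
  set S := sSup A with hS
  by_cases hSt : S = t
  · rw [← hSt]; exact hmem.2
  exfalso
  have hSlt : S < t := lt_of_le_of_ne hmem.1.2 hSt
  have hSpos : 0 < S := ht₀.trans_le hmem.1.1
  set s := min (S/2) (t - S) with hs
  have hspos : 0 < s := lt_min (by linarith) (by linarith)
  have hs1 : s ≤ S/2 := min_le_left _ _
  have hs2 : s ≤ t - S := min_le_right _ _
  have := extend_step M hMc hMne R hu x v hx hv S s hmem.2 hspos (by linarith) (by linarith)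
  have : S + s ∈ A := ⟨⟨by linarith [hmem.1.1], by linarith⟩, this⟩
  have := le_csSup hbdd this
  linarith
theorem det_symm_bounds {d : ℕ} (B : EuclideanSpace ℝ (Fin d) →ₗ[ℝ] EuclideanSpace ℝ (Fin d))
    (hB : B.IsSymmetric) (lo hi : ℝ) (hlo : 0 ≤ lo)
    (h1 : ∀ w, lo * ‖w‖ ^ 2 ≤ inner ℝ (B w) w) (h2 : ∀ w, inner ℝ (B w) w ≤ hi * ‖w‖ ^ 2) :
    lo ^ d ≤ LinearMap.det B ∧ LinearMap.det B ≤ hi ^ d := by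
  have hn : Module.finrank ℝ (EuclideanSpace ℝ (Fin d)) = d := by simp
  have hdet := hB.det_eq_prod_eigenvalues hn
  have hev : ∀ i, lo ≤ hB.eigenvalues hn i ∧ hB.eigenvalues hn i ≤ hi := by
    intro i
    have e := hB.apply_eigenvectorBasis hn i
    have nn : ‖hB.eigenvectorBasis hn i‖ = 1 := (hB.eigenvectorBasis hn).orthonormal.1 i
    have a1 := h1 (hB.eigenvectorBasis hn i)
    have a2 := h2 (hB.eigenvectorBasis hn i)
    rw [e, nn] at a1 a2
    simp [inner_smul_left, nn] at a1 a2
    exact ⟨a1, a2⟩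
  rw [hdet]
  simp only [RCLike.ofReal_real_eq_id, id]
  constructor
  · calc lo ^ d = ∏ i : Fin d, lo := by simp
      _ ≤ _ := Finset.prod_le_prod (fun _ _ => hlo) (fun i _ => (hev i).1)
  · calc _ ≤ ∏ i : Fin d, hi := Finset.prod_le_prod (fun i _ => hlo.trans (hev i).1) (fun i _ => (hev i).2)
      _ = hi ^ d := by simp

section
variable {N d : ℕ}

theorem inner_of_iso (D : EuclideanSpace ℝ (Fin d) →L[ℝ] EuclideanSpace ℝ (Fin N))
    (hD : ∀ w, ‖D w‖ = ‖w‖) (a b : EuclideanSpace ℝ (Fin d)) :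
    inner ℝ (D a) (D b) = inner ℝ a b :=
  (LinearIsometry.mk D.toLinearMap hD).inner_map_map a b

theorem adj_left (D : EuclideanSpace ℝ (Fin d) →L[ℝ] EuclideanSpace ℝ (Fin N))
    (hD : ∀ w, ‖D w‖ = ‖w‖) (a : EuclideanSpace ℝ (Fin d)) :
    ContinuousLinearMap.adjoint D (D a) = a := by
  apply ext_inner_right ℝ
  intro b
  rw [ContinuousLinearMap.adjoint_inner_left, inner_of_iso D hD]

theorem adj_norm_le (D : EuclideanSpace ℝ (Fin d) →L[ℝ] EuclideanSpace ℝ (Fin N))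
    (hD : ∀ w, ‖D w‖ = ‖w‖) (z : EuclideanSpace ℝ (Fin N)) :
    ‖ContinuousLinearMap.adjoint D z‖ ≤ ‖z‖ := by
  set a := ContinuousLinearMap.adjoint D z with ha
  have h : ‖a‖ * ‖a‖ ≤ ‖z‖ * ‖a‖ := by
    have h1 : inner ℝ a a = inner ℝ z (D a) := by
      conv_lhs => rw [ha]
      rw [ContinuousLinearMap.adjoint_inner_left]
    rw [← real_inner_self_eq_norm_mul_norm, h1]
    calc _ ≤ ‖z‖ * ‖D a‖ := real_inner_le_norm _ _
      _ = _ := by rw [hD]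
  by_cases h0 : ‖a‖ = 0
  · rw [h0]; positivity
  · exact le_of_mul_le_mul_right h (lt_of_le_of_ne (norm_nonneg _) (Ne.symm h0))

theorem sInf_angle (D : EuclideanSpace ℝ (Fin d) →L[ℝ] EuclideanSpace ℝ (Fin N))
    (hD : ∀ w, ‖D w‖ = ‖w‖) (T : Submodule ℝ (EuclideanSpace ℝ (Fin N)))
    (hT : Set.range D = (T : Set (EuclideanSpace ℝ (Fin N)))) (hd : 0 < d)
    (v : EuclideanSpace ℝ (Fin N)) (hv : v ≠ 0) :
    sInf {φ : ℝ | ∃ v₁ ∈ T, v₁ ≠ 0 ∧ φ = InnerProductGeometry.angle v v₁} =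
      Real.arccos (‖ContinuousLinearMap.adjoint D v‖ / ‖v‖) := by
  set a := ContinuousLinearMap.adjoint D v with ha
  have hvp : 0 < ‖v‖ := norm_pos_iff.2 hv
  have hmemT : ∀ w, D w ∈ T := fun w => by
    have : D w ∈ (T : Set (EuclideanSpace ℝ (Fin N))) := hT ▸ Set.mem_range_self w
    exact this
  have hDne : ∀ w, w ≠ 0 → D w ≠ 0 := fun w hw h => hw (by
    rw [← norm_eq_zero, ← hD, h, norm_zero])
  have hin : ∀ w, inner ℝ v (D w) = inner ℝ a w := fun w => by
    rw [ha, ContinuousLinearMap.adjoint_inner_left]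
  apply IsLeast.csInf_eq
  constructor
  · by_cases h0 : a = 0
    · have : Nonempty (Fin d) := ⟨⟨0, hd⟩⟩
      obtain ⟨w, hw⟩ := exists_ne (0 : EuclideanSpace ℝ (Fin d))
      refine ⟨D w, hmemT w, hDne w hw, ?_⟩
      unfold InnerProductGeometry.angle
      rw [hin, h0]; simp
    · refine ⟨D a, hmemT a, hDne a h0, ?_⟩
      unfold InnerProductGeometry.angle
      rw [hin, hD, real_inner_self_eq_norm_sq]
      have : 0 < ‖a‖ := norm_pos_iff.2 h0
      congr 1
      field_simp
  · rintro φ ⟨v₁, hv₁, hne, rfl⟩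
    have : v₁ ∈ Set.range D := by rw [hT]; exact hv₁
    obtain ⟨w, rfl⟩ := this
    unfold InnerProductGeometry.angle
    apply Real.antitone_arccos
    rw [hin, hD]
    have hw : 0 < ‖w‖ := by rw [← hD]; exact norm_pos_iff.2 hne
    rw [div_le_div_iff₀ (by positivity) hvp]
    nlinarith [real_inner_le_norm a w]

theorem cos_angle_bounds (D : EuclideanSpace ℝ (Fin d) →L[ℝ] EuclideanSpace ℝ (Fin N))
    (hD : ∀ w, ‖D w‖ = ‖w‖) (T : Submodule ℝ (EuclideanSpace ℝ (Fin N)))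
    (hT : Set.range D = (T : Set (EuclideanSpace ℝ (Fin N)))) (hd : 0 < d)
    (ι : EuclideanSpace ℝ (Fin d) →ₗᵢ[ℝ] EuclideanSpace ℝ (Fin N))
    (P : Submodule ℝ (EuclideanSpace ℝ (Fin N)))
    (hι : LinearMap.range ι.toLinearMap = P) :
    0 ≤ subspaceAngle P T ∧ subspaceAngle P T ≤ Real.pi / 2 ∧
    (∀ z, Real.cos (subspaceAngle P T) * ‖z‖ ≤ ‖ContinuousLinearMap.adjoint D (ι z)‖) ∧
    (∀ m : ℝ, 0 ≤ m → m ≤ 1 → (∀ z, m * ‖z‖ ≤ ‖ContinuousLinearMap.adjoint D (ι z)‖) →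
      m ≤ Real.cos (subspaceAngle P T)) := by
  have hmem : ∀ z, ι z ∈ P := fun z => by rw [← hι]; exact ⟨z, rfl⟩
  have hne : ∀ z, z ≠ 0 → ι z ≠ 0 := fun z hz h => hz (by
    rw [← norm_eq_zero, ← ι.norm_map, h, norm_zero])
  have hset : {θ : ℝ | ∃ v₀ ∈ P, v₀ ≠ 0 ∧
      θ = sInf {φ : ℝ | ∃ v₁ ∈ T, v₁ ≠ 0 ∧ φ = InnerProductGeometry.angle v₀ v₁}} =
      {θ : ℝ | ∃ z, z ≠ 0 ∧ θ = Real.arccos (‖ContinuousLinearMap.adjoint D (ι z)‖ / ‖z‖)} := by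
    ext θ
    constructor
    · rintro ⟨v₀, hv₀, h0, rfl⟩
      have hv₀' := hv₀
      rw [← hι] at hv₀'
      obtain ⟨z, rfl⟩ := hv₀'
      change ι z ≠ 0 at h0
      refine ⟨z, fun h => h0 (by rw [h, map_zero]), ?_⟩
      change sInf {φ : ℝ | ∃ v₁ ∈ T, v₁ ≠ 0 ∧ φ = InnerProductGeometry.angle (ι z) v₁} = _
      rw [sInf_angle D hD T hT hd _ h0, ι.norm_map]
    · rintro ⟨z, hz, rfl⟩
      refine ⟨ι z, hmem z, hne z hz, ?_⟩
      rw [sInf_angle D hD T hT hd _ (hne z hz), ι.norm_map]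
  have hdef : subspaceAngle P T = sSup {θ : ℝ | ∃ z, z ≠ 0 ∧
      θ = Real.arccos (‖ContinuousLinearMap.adjoint D (ι z)‖ / ‖z‖)} := by
    unfold subspaceAngle; rw [hset]
  set S := {θ : ℝ | ∃ z, z ≠ 0 ∧
      θ = Real.arccos (‖ContinuousLinearMap.adjoint D (ι z)‖ / ‖z‖)} with hS
  rw [hdef]
  have hub : ∀ θ ∈ S, θ ≤ Real.pi / 2 := by
    rintro θ ⟨z, hz, rfl⟩
    rw [Real.arccos_le_pi_div_two]; positivity
  have hbdd : BddAbove S := ⟨_, hub⟩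
  have : Nonempty (Fin d) := ⟨⟨0, hd⟩⟩
  obtain ⟨w, hw⟩ := exists_ne (0 : EuclideanSpace ℝ (Fin d))
  have hSne : S.Nonempty := ⟨_, w, hw, rfl⟩
  have h0 : 0 ≤ sSup S := Real.sSup_nonneg (by rintro θ ⟨z, hz, rfl⟩; exact Real.arccos_nonneg _)
  have hpi : sSup S ≤ Real.pi / 2 := csSup_le hSne hub
  refine ⟨h0, hpi, ?_, ?_⟩
  · intro z
    by_cases hz : z = 0
    · simp [hz]
    have hzp : 0 < ‖z‖ := norm_pos_iff.2 hz
    have hle : Real.arccos (‖ContinuousLinearMap.adjoint D (ι z)‖ / ‖z‖) ≤ sSup S :=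
      le_csSup hbdd ⟨z, hz, rfl⟩
    have := Real.cos_le_cos_of_nonneg_of_le_pi (Real.arccos_nonneg _) (by linarith [Real.pi_pos]) hle
    rw [Real.cos_arccos (by have : 0 ≤ ‖ContinuousLinearMap.adjoint D (ι z)‖ / ‖z‖ := by positivity
                            linarith)
      (by rw [div_le_one hzp]; simpa using adj_norm_le D hD (ι z)), le_div_iff₀ hzp] at this
    exact this
  · intro m hm hm1 hz
    have : sSup S ≤ Real.arccos m := by
      apply csSup_le hSne
      rintro θ ⟨z, hz0, rfl⟩
      apply Real.antitone_arccos
      rw [le_div_iff₀ (norm_pos_iff.2 hz0)]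
      exact hz z
    have := Real.cos_le_cos_of_nonneg_of_le_pi h0 (Real.arccos_le_pi m) this
    rwa [Real.cos_arccos (by linarith) hm1] at this

theorem det_proj_bounds (D : EuclideanSpace ℝ (Fin d) →L[ℝ] EuclideanSpace ℝ (Fin N))
    (hD : ∀ w, ‖D w‖ = ‖w‖) (T : Submodule ℝ (EuclideanSpace ℝ (Fin N)))
    (hT : Set.range D = (T : Set (EuclideanSpace ℝ (Fin N))))
    (ι : EuclideanSpace ℝ (Fin d) →ₗᵢ[ℝ] EuclideanSpace ℝ (Fin N))
    (P : Submodule ℝ (EuclideanSpace ℝ (Fin N)))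
    (hι : LinearMap.range ι.toLinearMap = P) :
    Real.cos (subspaceAngle P T) ^ min d (N - d) ≤
      |LinearMap.det ((ContinuousLinearMap.adjoint D).toLinearMap ∘ₗ ι.toLinearMap)| ∧
    |LinearMap.det ((ContinuousLinearMap.adjoint D).toLinearMap ∘ₗ ι.toLinearMap)| ≤
      Real.cos (subspaceAngle P T) := by
  rcases Nat.eq_zero_or_pos d with hd | hd
  · subst hd
    have hP : P = ⊥ := by
      rw [← hι]; rw [LinearMap.range_eq_bot]; ext z; simp [Subsingleton.elim z 0]
    have : subspaceAngle P T = 0 := by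
      unfold subspaceAngle
      convert Real.sSup_empty
      ext θ; simp [hP]
    rw [this, LinearMap.det_eq_one_of_finrank_eq_zero (by simp)]
    simp
  obtain ⟨hθ0, hθ1, hc1, hc2⟩ := cos_angle_bounds D hD T hT hd ι P hι
  set θ := subspaceAngle P T with hθ
  set C : EuclideanSpace ℝ (Fin d) →ₗ[ℝ] EuclideanSpace ℝ (Fin d) :=
    (ContinuousLinearMap.adjoint D).toLinearMap ∘ₗ ι.toLinearMap with hC
  have hCapp : ∀ z, C z = ContinuousLinearMap.adjoint D (ι z) := fun z => rfl
  have hcos0 : 0 ≤ Real.cos θ := Real.cos_nonneg_of_mem_Icc ⟨by linarith [Real.pi_pos], hθ1⟩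
  have hcos1 : Real.cos θ ≤ 1 := Real.cos_le_one θ
  set G := LinearMap.adjoint C ∘ₗ C with hG
  have hGs : G.IsSymmetric := LinearMap.isSymmetric_adjoint_mul_self C
  have hn : Module.finrank ℝ (EuclideanSpace ℝ (Fin d)) = d := by simp
  have hdet := hGs.det_eq_prod_eigenvalues hn
  have hdetG : LinearMap.det G = LinearMap.det C ^ 2 := by
    have hadj : LinearMap.det (LinearMap.adjoint C) = LinearMap.det C := by
      set b := EuclideanSpace.basisFun (Fin d) ℝ
      rw [← LinearMap.det_toMatrix b.toBasis, ← LinearMap.det_toMatrix b.toBasis,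
        LinearMap.toMatrix_adjoint b b, Matrix.det_conjTranspose]
      simp
    rw [hG, LinearMap.det_comp, hadj, sq]
  set μ := hGs.eigenvalues hn with hμ
  set e := hGs.eigenvectorBasis hn with he
  have hinG : ∀ a b, inner ℝ (G a) b = inner ℝ (C a) (C b) := fun a b => by
    rw [hG, LinearMap.comp_apply, LinearMap.adjoint_inner_left]
  have hGe : ∀ i, G (e i) = μ i • e i := fun i => by
    exact hGs.apply_eigenvectorBasis hn i
  have hCe : ∀ i j, inner ℝ (C (e i)) (C (e j)) = if i = j then μ i else 0 := fun i j => by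
    rw [← hinG, hGe, real_inner_smul_left, orthonormal_iff_ite.1 e.orthonormal]
    split_ifs <;> simp
  have hCn : ∀ i, ‖C (e i)‖ ^ 2 = μ i := fun i => by
    rw [← real_inner_self_eq_norm_sq, hCe]; simp
  have hen : ∀ i, ‖e i‖ = 1 := fun i => e.orthonormal.1 i
  have hCle : ∀ z, ‖C z‖ ≤ ‖z‖ := fun z => by
    rw [hCapp]; simpa using adj_norm_le D hD (ι z)
  have hμ1 : ∀ i, μ i ≤ 1 := fun i => by
    rw [← hCn]
    have := hCle (e i); rw [hen] at this
    exact pow_le_one₀ (norm_nonneg _) this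
  have hμ0 : ∀ i, 0 ≤ μ i := fun i => by rw [← hCn]; positivity
  have hμc : ∀ i, Real.cos θ ^ 2 ≤ μ i := fun i => by
    rw [← hCn]
    have := hc1 (e i); rw [hen, mul_one] at this
    exact pow_le_pow_left₀ hcos0 this 2
  have hdet2 : LinearMap.det C ^ 2 = ∏ i, μ i := by rw [← hdetG, hdet]; simp
  constructor
  · -- lower bound
    set J := Finset.univ.filter (fun i => μ i ≠ 1) with hJ
    have hcard : J.card ≤ min d (N - d) := by
      apply le_min
      · simpa using Finset.card_le_univ J
      · -- vectors f i = ι e_i - D (C e_i)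
        let f : J → EuclideanSpace ℝ (Fin N) := fun i => ι (e i) - D (C (e i))
        have hfin : ∀ i j, inner ℝ (ι (e i) - D (C (e i))) (ι (e j) - D (C (e j))) =
            if i = j then 1 - μ i else 0 := by
          intro i j
          have a1 : inner ℝ (ι (e i)) (D (C (e j))) = inner ℝ (C (e i)) (C (e j)) := by
            rw [← ContinuousLinearMap.adjoint_inner_left]; rfl
          have a2 : inner ℝ (D (C (e i))) (ι (e j)) = inner ℝ (C (e i)) (C (e j)) := by
            rw [← ContinuousLinearMap.adjoint_inner_right]; rfl
          rw [inner_sub_left, inner_sub_right, inner_sub_right, a1, a2, inner_of_iso D hD,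
            ι.inner_map_map, orthonormal_iff_ite.1 e.orthonormal, hCe]
          split_ifs <;> ring
        have hli : LinearIndependent ℝ f := by
          apply linearIndependent_of_ne_zero_of_inner_eq_zero
          · intro i h0
            have := hfin i i
            change inner ℝ (f i) (f i) = _ at this
            rw [h0] at this
            simp at this
            have h1 := (Finset.mem_filter.1 i.2).2
            exact h1 (by linarith)
          · intro i j hij
            change inner ℝ (ι (e i) - D (C (e i))) (ι (e j) - D (C (e j))) = 0
            rw [hfin, if_neg]
            intro h; exact hij (Subtype.ext h)
        have hTr : T = LinearMap.range D.toLinearMap := by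
          ext z
          rw [← SetLike.mem_coe, ← hT]; simp
        have hperp : ∀ i, f i ∈ Tᗮ := by
          intro i
          rw [Submodule.mem_orthogonal]
          intro u hu
          rw [hTr] at hu
          obtain ⟨w, rfl⟩ := hu
          change inner ℝ (D w) (ι (e i) - D (C (e i))) = 0
          rw [inner_sub_right, inner_of_iso D hD, ← ContinuousLinearMap.adjoint_inner_right]
          exact sub_self _
        have hfr : Module.finrank ℝ T = d := by
          rw [hTr, LinearMap.finrank_range_of_inj]
          · simp
          · intro a b hab
            have : D a = D b := hab
            rw [← adj_left D hD a, this, adj_left D hD]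
        have hfr' : Module.finrank ℝ Tᗮ = N - d := by
          have := Submodule.finrank_add_finrank_orthogonal T
          simp only [finrank_euclideanSpace, Fintype.card_fin, hfr] at this
          omega
        let f' : J → Tᗮ := fun i => ⟨f i, hperp i⟩
        have hli' : LinearIndependent ℝ f' := by
          apply LinearIndependent.of_comp (Tᗮ.subtype)
          exact hli
        have := hli'.fintype_card_le_finrank
        rw [hfr'] at this
        simpa using this
    have : (Real.cos θ ^ min d (N - d)) ^ 2 ≤ LinearMap.det C ^ 2 := by
      rw [hdet2, ← Finset.prod_filter_mul_prod_filter_not Finset.univ (fun i => μ i ≠ 1)]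
      have : ∏ i ∈ Finset.univ.filter (fun i => ¬ μ i ≠ 1), μ i = 1 := by
        apply Finset.prod_eq_one
        intro i hi
        simpa using (Finset.mem_filter.1 hi).2
      rw [this, mul_one]
      calc (Real.cos θ ^ min d (N - d)) ^ 2 ≤ (Real.cos θ ^ J.card) ^ 2 :=
            pow_le_pow_left₀ (by positivity) (pow_le_pow_of_le_one hcos0 hcos1 hcard) 2
        _ = ∏ i ∈ J, Real.cos θ ^ 2 := by rw [Finset.prod_const, ← pow_mul, ← pow_mul, mul_comm]
        _ ≤ _ := Finset.prod_le_prod (fun _ _ => by positivity) (fun i _ => hμc i)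
    have := sq_le_sq.1 this
    rwa [abs_of_nonneg (by positivity)] at this
  · have : Nonempty (Fin d) := ⟨⟨0, hd⟩⟩
    obtain ⟨i₀, hi₀⟩ := Finite.exists_min μ
    have hz : ∀ z, √(μ i₀) * ‖z‖ ≤ ‖C z‖ := by
      intro z
      refine (pow_le_pow_iff_left₀ (by positivity) (norm_nonneg _) two_ne_zero).1 ?_
      rw [mul_pow, Real.sq_sqrt (hμ0 _)]
      have hz2 : ‖z‖ ^ 2 = ∑ i, (e.repr z i) ^ 2 := by
        rw [← e.repr.norm_map z, EuclideanSpace.norm_sq_eq]; simp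
      have hcz : ‖C z‖ ^ 2 = ∑ i, μ i * (e.repr z i) ^ 2 := by
        rw [← real_inner_self_eq_norm_sq, ← hinG, ← e.sum_inner_mul_inner]
        apply Finset.sum_congr rfl
        intro i _
        rw [hGs z (e i), hGe, real_inner_smul_right, e.repr_apply_apply, real_inner_comm]
        ring
      rw [hz2, hcz, Finset.mul_sum]
      exact Finset.sum_le_sum fun i _ => mul_le_mul_of_nonneg_right (hi₀ i) (sq_nonneg _)
    have hm := hc2 (√(μ i₀)) (Real.sqrt_nonneg _) (Real.sqrt_le_one.2 (hμ1 i₀)) hz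
    refine le_trans ?_ hm
    apply Real.le_sqrt_of_sq_le
    rw [sq_abs, hdet2, ← Finset.mul_prod_erase _ _ (Finset.mem_univ i₀)]
    exact mul_le_of_le_one_right (hμ0 _) (Finset.prod_le_one (fun i _ => hμ0 i) (fun i _ => hμ1 i))

end
open Filter Topology in
theorem graph_chart {N d : ℕ} (M : Set (EuclideanSpace ℝ (Fin N)))
    (hM : IsC2Submanifold d M)
    (x : EuclideanSpace ℝ (Fin N)) (hx : x ∈ M)
    (U₀ : Set (EuclideanSpace ℝ (Fin d))) (hU₀ : IsOpen U₀)
    (ξ : EuclideanSpace ℝ (Fin d) → EuclideanSpace ℝ (Fin N))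
    (u₀ : EuclideanSpace ℝ (Fin d)) (hu₀ : u₀ ∈ U₀) (hξx : ξ u₀ = x)
    (hξC2 : ContDiffOn ℝ 2 ξ U₀) (hξinj : Set.InjOn ξ U₀) (hξM : ξ '' U₀ ⊆ M)
    (hξiso : ∀ w, ‖fderivWithin ℝ ξ U₀ u₀ w‖ = ‖w‖)
    (hξtan : Set.range (fderivWithin ℝ ξ U₀ u₀) =
      (tangentSpan M x : Set (EuclideanSpace ℝ (Fin N)))) :
    ∃ (D : EuclideanSpace ℝ (Fin d) →L[ℝ] EuclideanSpace ℝ (Fin N))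
      (ψ : EuclideanSpace ℝ (Fin d) → EuclideanSpace ℝ (Fin N))
      (k : EuclideanSpace ℝ (Fin d) → EuclideanSpace ℝ (Fin d)),
      (∀ w, ‖D w‖ = ‖w‖) ∧
      Set.range D = (tangentSpan M x : Set (EuclideanSpace ℝ (Fin N))) ∧
      ContDiffAt ℝ 2 ψ (ContinuousLinearMap.adjoint D x) ∧
      HasFDerivAt ψ D (ContinuousLinearMap.adjoint D x) ∧
      ψ (ContinuousLinearMap.adjoint D x) = x ∧
      (∀ᶠ a in 𝓝 (ContinuousLinearMap.adjoint D x), ψ a ∈ M) ∧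
      (∀ᶠ m in 𝓝[M] x, ψ (ContinuousLinearMap.adjoint D m) = m) ∧
      HasFDerivAt k (ContinuousLinearMap.id ℝ _) (ContinuousLinearMap.adjoint D x) ∧
      (∀ᶠ m in 𝓝[M] x, Function.invFunOn ξ U₀ m = k (ContinuousLinearMap.adjoint D m)) := by
  have hfw : fderivWithin ℝ ξ U₀ u₀ = fderiv ℝ ξ u₀ := fderivWithin_of_isOpen hU₀ hu₀
  rw [hfw] at hξiso hξtan
  set D := fderiv ℝ ξ u₀ with hDdef
  set A := ContinuousLinearMap.adjoint D with hA
  have hAD : ∀ w, A (D w) = w := adj_left D hξiso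
  have hcd : ContDiffAt ℝ 2 ξ u₀ := hξC2.contDiffAt (hU₀.mem_nhds hu₀)
  have hDξ : HasFDerivAt ξ D u₀ := (hcd.differentiableAt (by norm_num)).hasFDerivAt
  -- the local coordinate map
  have hh : ContDiffAt ℝ 2 (fun u => A (ξ u)) u₀ := A.contDiff.contDiffAt.comp u₀ hcd
  have hh' : HasFDerivAt (fun u => A (ξ u))
      ((ContinuousLinearEquiv.refl ℝ (EuclideanSpace ℝ (Fin d)) :
        EuclideanSpace ℝ (Fin d) →L[ℝ] EuclideanSpace ℝ (Fin d))) u₀ := by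
    have := A.hasFDerivAt.comp u₀ hDξ
    refine this.congr_fderiv ?_
    ext1 w
    simp [hAD]
  have hstrict := hh.hasStrictFDerivAt' hh' (by norm_num)
  set k := hh.localInverse hh' (by norm_num) with hk
  have hk0 : k (A x) = u₀ := by
    have := hh.localInverse_apply_image hh' (by norm_num)
    simpa [hξx] using this
  have hkC : ContDiffAt ℝ 2 k (A x) := by
    have := hh.to_localInverse hh' (by norm_num)
    simpa [hξx] using this
  have hkD : HasFDerivAt k (ContinuousLinearMap.id ℝ _) (A x) := by
    have := hstrict.to_localInverse.hasFDerivAt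
    simp only [hξx] at this
    exact this
  have hkr : ∀ᶠ a in 𝓝 (A x), A (ξ (k a)) = a := by
    have := hstrict.eventually_right_inverse
    simp only [hξx] at this
    exact this
  have hkU : ∀ᶠ a in 𝓝 (A x), k a ∈ U₀ := by
    apply hkC.continuousAt.eventually
    rw [hk0]; exact hU₀.mem_nhds hu₀
  have hψM : ∀ᶠ a in 𝓝 (A x), ξ (k a) ∈ M := by
    filter_upwards [hkU] with a ha
    exact hξM ⟨_, ha, rfl⟩
  have hψC : ContDiffAt ℝ 2 (fun a => ξ (k a)) (A x) := by
    apply ContDiffAt.comp (A x) _ hkC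
    rw [hk0]; exact hcd
  have hψD : HasFDerivAt (fun a => ξ (k a)) D (A x) := by
    have h1 : HasFDerivAt ξ D (k (A x)) := by rw [hk0]; exact hDξ
    have := h1.comp (A x) hkD
    rw [ContinuousLinearMap.comp_id] at this
    exact this
  have hAt : Tendsto A (𝓝[M] x) (𝓝 (A x)) := A.continuous.continuousAt.mono_left nhdsWithin_le_nhds
  -- the chart of `M`
  have hgraph : ∀ᶠ m in 𝓝[M] x, ξ (k (A m)) = m := by
    obtain ⟨U, ξ₁, V, hU, hV, hxV, hC₁, hinj₁, him, himm, hcont⟩ := hM x hx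
    have hx1 : x ∈ M ∩ V := ⟨hx, hxV⟩
    set u₁ := Function.invFunOn ξ₁ U x with hu₁
    have hsurj : ∀ m ∈ M ∩ V, Function.invFunOn ξ₁ U m ∈ U ∧ ξ₁ (Function.invFunOn ξ₁ U m) = m := by
      intro m hm
      rw [← him] at hm
      exact ⟨Function.invFunOn_mem hm, Function.invFunOn_eq hm⟩
    have hu₁U : u₁ ∈ U := (hsurj x hx1).1
    have hξu₁ : ξ₁ u₁ = x := (hsurj x hx1).2
    have hcd₁ : ContDiffAt ℝ 2 ξ₁ u₁ := hC₁.contDiffAt (hU.mem_nhds hu₁U)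
    have hinjD := himm u₁ hu₁U
    rw [fderivWithin_of_isOpen hU hu₁U] at hinjD
    set D₁ := fderiv ℝ ξ₁ u₁ with hD₁
    have hDξ₁ : HasFDerivAt ξ₁ D₁ u₁ := (hcd₁.differentiableAt (by norm_num)).hasFDerivAt
    have hD₁T : ∀ w, D₁ w ∈ tangentSpan M x := by
      intro w
      apply Submodule.subset_span
      have h1 := HasFDerivWithinAt.mapsTo_tangent_cone (hDξ₁.hasFDerivWithinAt (s := U))
      rw [tangentConeAt_of_mem_nhds (hU.mem_nhds hu₁U), him, hξu₁] at h1
      exact tangentConeAt_mono Set.inter_subset_left (h1 (Set.mem_univ w))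
    have hAinj : Function.Injective (A ∘L D₁) := by
      intro a b hab
      apply hinjD
      have ha : D₁ a ∈ Set.range D := by rw [hξtan]; exact hD₁T a
      have hb : D₁ b ∈ Set.range D := by rw [hξtan]; exact hD₁T b
      obtain ⟨a', ha'⟩ := ha
      obtain ⟨b', hb'⟩ := hb
      have : A (D₁ a) = A (D₁ b) := hab
      rw [← ha', ← hb', hAD, hAD] at this
      rw [← ha', ← hb', this]
    let L : EuclideanSpace ℝ (Fin d) ≃L[ℝ] EuclideanSpace ℝ (Fin d) :=
      (LinearEquiv.ofInjectiveEndo (A ∘L D₁).toLinearMap hAinj).toContinuousLinearEquiv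
    have hL : (L : EuclideanSpace ℝ (Fin d) →L[ℝ] EuclideanSpace ℝ (Fin d)) = A ∘L D₁ := by
      ext w : 1
      rfl
    have hh₁ : HasFDerivAt (fun u => A (ξ₁ u))
        (L : EuclideanSpace ℝ (Fin d) →L[ℝ] EuclideanSpace ℝ (Fin d)) u₁ := by
      rw [hL]; exact A.hasFDerivAt.comp u₁ hDξ₁
    have hhC₁ : ContDiffAt ℝ 2 (fun u => A (ξ₁ u)) u₁ := A.contDiff.contDiffAt.comp u₁ hcd₁
    have hst₁ := hhC₁.hasStrictFDerivAt' hh₁ (by norm_num)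
    set L₁ := hst₁.localInverse with hL₁
    have hleft : ∀ᶠ u in 𝓝 u₁, L₁ (A (ξ₁ u)) = u := hst₁.eventually_left_inverse
    have hMV : ∀ᶠ m in 𝓝[M] x, m ∈ M ∩ V := by
      filter_upwards [self_mem_nhdsWithin, nhdsWithin_le_nhds (hV.mem_nhds hxV)] with m h1 h2
      exact ⟨h1, h2⟩
    have hct : Tendsto (Function.invFunOn ξ₁ U) (𝓝[M] x) (𝓝 u₁) := by
      have := hcont x hx1
      unfold ContinuousWithinAt at this
      rwa [nhdsWithin_inter_of_mem' (nhdsWithin_le_nhds (hV.mem_nhds hxV))] at this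
    have hfix : ∀ᶠ m in 𝓝[M] x, m = ξ₁ (L₁ (A m)) := by
      filter_upwards [hMV, hct.eventually hleft] with m hm h
      rw [(hsurj m hm).2] at h
      rw [h, (hsurj m hm).2]
    have ht : Tendsto (fun m => ξ (k (A m))) (𝓝[M] x) (𝓝[M] x) := by
      rw [tendsto_nhdsWithin_iff]
      refine ⟨?_, hAt.eventually hψM⟩
      have h1 : Tendsto (fun a => ξ (k a)) (𝓝 (A x)) (𝓝 x) := by
        have := hψC.continuousAt.tendsto
        simpa [hk0, hξx] using this
      exact h1.comp hAt
    filter_upwards [hfix, ht.eventually hfix, hAt.eventually hkr] with m h1 h2 h3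
    rw [h3] at h2
    rw [h2, ← h1]
  refine ⟨D, fun a => ξ (k a), k, hξiso, hξtan, hψC, hψD, ?_, hψM, hgraph, hkD, ?_⟩
  · change ξ (k (A x)) = x
    rw [hk0, hξx]
  · filter_upwards [hgraph, hAt.eventually hkU] with m h1 h2
    have hm : m ∈ ξ '' U₀ := ⟨k (A m), h2, h1⟩
    apply hξinj (Function.invFunOn_mem hm) h2
    rw [Function.invFunOn_eq hm]; exact h1.symm
section
open Filter Topology

theorem quad_bound {F : Type*} [NormedAddCommGroup F] [NormedSpace ℝ F] (k : F → ℝ) (a₀ : F)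
    (hk : ContDiffAt ℝ 2 k a₀) (h0 : k a₀ = 0) (h1 : fderiv ℝ k a₀ = 0) :
    ∃ C : ℝ, 0 ≤ C ∧ ∀ᶠ a in 𝓝 a₀, |k a| ≤ C * ‖a - a₀‖ ^ 2 := by
  have hf : ContDiffAt ℝ 1 (fderiv ℝ k) a₀ := hk.fderiv_right (m := 1) (by norm_num)
  obtain ⟨K, t, ht, hL⟩ := hf.exists_lipschitzOnWith
  have hd : ∀ᶠ a in 𝓝 a₀, DifferentiableAt ℝ k a := by
    filter_upwards [hk.eventually (by norm_num)] with a ha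
    exact ha.differentiableAt (by norm_num)
  obtain ⟨r, hr, hball⟩ := Metric.eventually_nhds_iff_ball.1 (hd.and (show ∀ᶠ a in 𝓝 a₀, a ∈ t from ht))
  refine ⟨K, K.2, ?_⟩
  filter_upwards [Metric.ball_mem_nhds a₀ hr] with a ha
  have hsub : ∀ z ∈ Metric.closedBall a₀ ‖a - a₀‖, z ∈ Metric.ball a₀ r := by
    intro z hz
    rw [Metric.mem_closedBall] at hz
    rw [Metric.mem_ball] at ha ⊢
    rw [← dist_eq_norm] at hz
    linarith
  have := (convex_closedBall a₀ ‖a - a₀‖).norm_image_sub_le_of_norm_fderiv_le (𝕜 := ℝ) (f := k)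
    (C := K * ‖a - a₀‖) (x := a₀) (y := a) (fun z hz => (hball z (hsub z hz)).1)
    (fun z hz => by
      have hl := hL.dist_le_mul z (hball z (hsub z hz)).2 a₀ (hball a₀ (Metric.mem_ball_self hr)).2
      rw [dist_eq_norm, h1, sub_zero] at hl
      refine hl.trans ?_
      gcongr
      exact hz) (Metric.mem_closedBall_self (norm_nonneg _)) (by simp [dist_eq_norm])
  rw [h0, sub_zero, Real.norm_eq_abs] at this
  linarith [this]

theorem second_order {f f' : ℝ → ℝ} {c : ℝ} (hmin : IsLocalMin f 0)
    (hf : ∀ᶠ s in 𝓝 0, HasDerivAt f (f' s) s) (hc : HasDerivAt f' c 0) : 0 ≤ c := by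
  by_contra hneg
  push Not at hneg
  have heq : deriv f =ᶠ[𝓝 0] f' := hf.mono fun s hs => hs.deriv
  have hdd : deriv (deriv f) 0 = c := by rw [heq.deriv_eq]; exact hc.deriv
  have hd0 : deriv f 0 = 0 := hmin.deriv_eq_zero
  have hcont : ContinuousAt f 0 := hf.self_of_nhds.continuousAt
  have hmax := isLocalMax_of_deriv_deriv_neg (by rw [hdd]; exact hneg) hd0 hcont
  have hconst : f =ᶠ[𝓝 0] fun _ => f 0 := by
    filter_upwards [hmin, hmax] with s h1 h2
    exact le_antisymm h2 h1
  have h2 : deriv f =ᶠ[𝓝 0] deriv (fun _ => f 0) := hconst.deriv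
  have h3 : deriv (deriv f) 0 = 0 := by rw [h2.deriv_eq]; simp
  linarith

variable {N d : ℕ}

/-- the real inner product as a continuous bilinear map -/
noncomputable def innR (N : ℕ) : EuclideanSpace ℝ (Fin N) →L[ℝ] EuclideanSpace ℝ (Fin N) →L[ℝ] ℝ :=
  (innerₗ (EuclideanSpace ℝ (Fin N))).mkContinuous₂ 1 (fun x y => by
    simpa using norm_inner_le_norm (𝕜 := ℝ) x y)

theorem innR_apply (a b : EuclideanSpace ℝ (Fin N)) : innR N a b = inner ℝ a b := rfl

theorem small_ray (M : Set (EuclideanSpace ℝ (Fin N))) (hMc : IsCompact M)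
    (x : EuclideanSpace ℝ (Fin N)) (hx : x ∈ M)
    (D : EuclideanSpace ℝ (Fin d) →L[ℝ] EuclideanSpace ℝ (Fin N))
    (hD : ∀ w, ‖D w‖ = ‖w‖)
    (ψ : EuclideanSpace ℝ (Fin d) → EuclideanSpace ℝ (Fin N))
    (hψC : ContDiffAt ℝ 2 ψ (ContinuousLinearMap.adjoint D x))
    (hψD : HasFDerivAt ψ D (ContinuousLinearMap.adjoint D x))
    (hψx : ψ (ContinuousLinearMap.adjoint D x) = x)
    (hgr : ∀ᶠ m in 𝓝[M] x, ψ (ContinuousLinearMap.adjoint D m) = m)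
    (v : EuclideanSpace ℝ (Fin N)) (hv : ‖v‖ = 1) (hvD : ∀ w, inner ℝ v (D w) = 0) :
    ∃ t₀ : ℝ, 0 < t₀ ∧ Metric.infDist (x + t₀ • v) M = t₀ := by
  set A := ContinuousLinearMap.adjoint D with hA
  obtain ⟨C, hC, hq⟩ := quad_bound (fun a => innR N v (ψ a - x)) (A x)
    ((innR N v).contDiff.contDiffAt.comp _ (hψC.sub contDiffAt_const))
    (by simp [hψx]) (by
      have := (innR N v).hasFDerivAt.comp (A x) (hψD.sub_const x)
      have h2 := this.fderiv
      change fderiv ℝ (fun a => innR N v (ψ a - x)) (A x) = _ at h2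
      rw [h2]
      ext1 w
      simp [innR_apply, hvD])
  have hAt : Tendsto A (𝓝[M] x) (𝓝 (A x)) := A.continuous.continuousAt.mono_left nhdsWithin_le_nhds
  have hev : ∀ᶠ m in 𝓝[M] x, |inner ℝ v (m - x)| ≤ C * ‖m - x‖ ^ 2 := by
    filter_upwards [hgr, hAt.eventually hq] with m h1 h2
    rw [h1, innR_apply, ← map_sub] at h2
    refine h2.trans ?_
    gcongr
    exact adj_norm_le D hD _
  obtain ⟨r, hr, hball⟩ := Metric.mem_nhdsWithin_iff.1 hev
  set t := min (r / 4) (1 / (2 * C + 1)) with ht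
  have htp : 0 < t := by positivity
  have ht1 : t ≤ r / 4 := min_le_left _ _
  have ht2 : t * (2 * C + 1) ≤ 1 := by
    have : t ≤ 1 / (2 * C + 1) := min_le_right _ _
    rwa [le_div_iff₀ (by positivity)] at this
  refine ⟨t, htp, ?_⟩
  have hdx : dist (x + t • v) x = t := by
    rw [dist_eq_norm]; simp [norm_smul, hv, abs_of_pos htp]
  obtain ⟨m, hm, hmd⟩ := hMc.exists_infDist_eq_dist ⟨x, hx⟩ (x + t • v)
  have hle : Metric.infDist (x + t • v) M ≤ t :=
    (Metric.infDist_le_dist_of_mem hx).trans hdx.le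
  refine le_antisymm hle ?_
  have hmx : dist m x < r := by
    have := dist_triangle m (x + t • v) x
    rw [hdx, dist_comm m (x + t • v), ← hmd] at this
    linarith
  have hb : |inner ℝ v (m - x)| ≤ C * ‖m - x‖ ^ 2 := hball ⟨hmx, hm⟩
  rw [hmd, dist_eq_norm]
  refine (pow_le_pow_iff_left₀ htp.le (norm_nonneg _) two_ne_zero).1 ?_
  have e : x + t • v - m = t • v - (m - x) := by abel
  rw [e, norm_sub_sq_real, real_inner_smul_left, norm_smul, hv, Real.norm_eq_abs, abs_of_pos htp]
  have h3 := (le_abs_self _).trans hb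
  have h4 : t * inner ℝ v (m - x) ≤ t * (C * ‖m - x‖ ^ 2) := mul_le_mul_of_nonneg_left h3 htp.le
  have h5 : 0 ≤ (1 - 2 * t * C) * ‖m - x‖ ^ 2 := by
    apply mul_nonneg _ (sq_nonneg _)
    nlinarith
  nlinarith

theorem curvature_bound (M : Set (EuclideanSpace ℝ (Fin N)))
    (x : EuclideanSpace ℝ (Fin N))
    (D : EuclideanSpace ℝ (Fin d) →L[ℝ] EuclideanSpace ℝ (Fin N))
    (hD : ∀ w, ‖D w‖ = ‖w‖)
    (ψ : EuclideanSpace ℝ (Fin d) → EuclideanSpace ℝ (Fin N)) (a₀ : EuclideanSpace ℝ (Fin d))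
    (hψC : ContDiffAt ℝ 2 ψ a₀)
    (hψD : HasFDerivAt ψ D a₀)
    (hψx : ψ a₀ = x)
    (hψM : ∀ᶠ a in 𝓝 a₀, ψ a ∈ M)
    (v : EuclideanSpace ℝ (Fin N)) (hv : ‖v‖ = 1) (t : ℝ) (ht0 : 0 ≤ t)
    (ht : Metric.infDist (x + t • v) M = t) (w : EuclideanSpace ℝ (Fin d)) :
    t * inner ℝ v (fderiv ℝ (fderiv ℝ ψ) a₀ w w) ≤ ‖w‖ ^ 2 := by
  have hlin : Tendsto (fun s : ℝ => a₀ + s • w) (𝓝 0) (𝓝 a₀) := by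
    have : Continuous (fun s : ℝ => a₀ + s • w) := by fun_prop
    simpa using this.tendsto 0
  have hlind : ∀ s : ℝ, HasDerivAt (fun s : ℝ => a₀ + s • w) w s := by
    intro s
    simpa using ((hasDerivAt_id s).smul_const w).const_add a₀
  have hdiff : ∀ᶠ a in 𝓝 a₀, HasFDerivAt ψ (fderiv ℝ ψ a) a := by
    filter_upwards [hψC.eventually (by norm_num)] with a ha
    exact (ha.differentiableAt (by norm_num)).hasFDerivAt
  have hH : HasFDerivAt (fderiv ℝ ψ) (fderiv ℝ (fderiv ℝ ψ) a₀) a₀ :=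
    ((hψC.fderiv_right (m := 1) (by norm_num)).differentiableAt (by norm_num)).hasFDerivAt
  set H := fderiv ℝ (fderiv ℝ ψ) a₀ with hHdef
  set q := x + t • v with hq
  have hc1 : ∀ᶠ s : ℝ in 𝓝 0, HasDerivAt (fun s : ℝ => ψ (a₀ + s • w) - q)
      (fderiv ℝ ψ (a₀ + s • w) w) s := by
    filter_upwards [hlin.eventually hdiff] with s hs
    exact (hs.comp_hasDerivAt s (hlind s)).sub_const q
  have hc2 : HasDerivAt (fun s : ℝ => fderiv ℝ ψ (a₀ + s • w) w) (H w w) 0 := by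
    have h1 : HasFDerivAt (fderiv ℝ ψ) H (a₀ + (0 : ℝ) • w) := by simpa using hH
    have h2 := h1.comp_hasDerivAt (0 : ℝ) (hlind 0)
    simpa using h2.clm_apply (hasDerivAt_const (0 : ℝ) w)
  have hmin : IsLocalMin (fun s : ℝ => inner ℝ (ψ (a₀ + s • w) - q) (ψ (a₀ + s • w) - q)) 0 := by
    filter_upwards [hlin.eventually hψM] with s hs
    have h1 : Metric.infDist q M ≤ dist q (ψ (a₀ + s • w)) := Metric.infDist_le_dist_of_mem hs
    rw [ht, dist_comm, dist_eq_norm] at h1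
    rw [real_inner_self_eq_norm_sq, real_inner_self_eq_norm_sq]
    have h0 : ‖ψ (a₀ + (0 : ℝ) • w) - q‖ = t := by
      simp [hψx, hq, norm_smul, hv, abs_of_nonneg ht0]
    rw [h0]
    exact pow_le_pow_left₀ ht0 h1 2
  have hder := second_order (f' := fun s => inner ℝ (ψ (a₀ + s • w) - q) (fderiv ℝ ψ (a₀ + s • w) w)
      + inner ℝ (fderiv ℝ ψ (a₀ + s • w) w) (ψ (a₀ + s • w) - q))
    (hmin) (by
      filter_upwards [hc1] with s hs
      exact hs.inner ℝ hs)
    ((hc1.self_of_nhds.inner ℝ hc2).add (hc2.inner ℝ hc1.self_of_nhds))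
  have e1 : fderiv ℝ ψ a₀ = D := hψD.fderiv
  simp only [zero_smul, add_zero, e1, hψx] at hder
  have e2 : x - q = -(t • v) := by rw [hq]; abel
  rw [e2, real_inner_comm (-(t • v)) (H w w), inner_neg_left, real_inner_smul_left, real_inner_self_eq_norm_sq, hD] at hder
  linarith

end
section
open Filter Topology
variable {N d : ℕ}

theorem implicit_proj
    (D : EuclideanSpace ℝ (Fin d) →L[ℝ] EuclideanSpace ℝ (Fin N))
    (hD : ∀ w, ‖D w‖ = ‖w‖)
    (ψ : EuclideanSpace ℝ (Fin d) → EuclideanSpace ℝ (Fin N)) (a₀ : EuclideanSpace ℝ (Fin d))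
    (hψC : ContDiffAt ℝ 2 ψ a₀) (hψD : HasFDerivAt ψ D a₀)
    (y : EuclideanSpace ℝ (Fin N))
    (hpos : ∀ w, w ≠ 0 → inner ℝ (y - ψ a₀) (fderiv ℝ (fderiv ℝ ψ) a₀ w w) < ‖w‖ ^ 2)
    (g : EuclideanSpace ℝ (Fin N) → EuclideanSpace ℝ (Fin d))
    (hg : Tendsto g (𝓝 y) (𝓝 a₀)) (hgy : g y = a₀)
    (hcrit : ∀ᶠ p in 𝓝 y, ∀ w, inner ℝ (p - ψ (g p)) (fderiv ℝ ψ (g p) w) = 0) :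
    ContDiffAt ℝ 1 g y ∧ ∀ p w', inner ℝ (p - D (fderiv ℝ g y p)) (D w')
      + inner ℝ (y - ψ a₀) (fderiv ℝ (fderiv ℝ ψ) a₀ (fderiv ℝ g y p) w') = 0 := by
  have hψ' : ContDiffAt ℝ 1 (fderiv ℝ ψ) a₀ := hψC.fderiv_right (m := 1) (by norm_num)
  have hH : HasFDerivAt (fderiv ℝ ψ) (fderiv ℝ (fderiv ℝ ψ) a₀) a₀ :=
    (hψ'.differentiableAt (by norm_num)).hasFDerivAt
  set H := fderiv ℝ (fderiv ℝ ψ) a₀ with hHdef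
  let Fn : EuclideanSpace ℝ (Fin N) × EuclideanSpace ℝ (Fin d) → (EuclideanSpace ℝ (Fin d) →L[ℝ] ℝ) :=
    fun q => (innR N (q.1 - ψ q.2)).comp (fderiv ℝ ψ q.2)
  have c1 : ContDiffAt ℝ 1 (fun q : EuclideanSpace ℝ (Fin N) × EuclideanSpace ℝ (Fin d) => ψ q.2)
      (y, a₀) := (hψC.of_le (by norm_num)).comp (y, a₀) contDiffAt_snd
  have c2 : ContDiffAt ℝ 1 (fun q : EuclideanSpace ℝ (Fin N) × EuclideanSpace ℝ (Fin d) => fderiv ℝ ψ q.2)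
      (y, a₀) := hψ'.comp (y, a₀) contDiffAt_snd
  have c3 : ContDiffAt ℝ 1 (fun q : EuclideanSpace ℝ (Fin N) × EuclideanSpace ℝ (Fin d) => innR N (q.1 - ψ q.2))
      (y, a₀) := (innR N).contDiff.contDiffAt.comp (y, a₀) (contDiffAt_fst.sub c1)
  have cF : ContDiffAt ℝ 1 Fn (y, a₀) := c3.clm_comp c2
  have hFd : HasFDerivAt Fn (fderiv ℝ Fn (y, a₀)) (y, a₀) :=
    (cF.differentiableAt (by norm_num)).hasFDerivAt
  have d1 : HasFDerivAt (fun q : EuclideanSpace ℝ (Fin N) × EuclideanSpace ℝ (Fin d) => ψ q.2)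
      (D.comp (ContinuousLinearMap.snd ℝ _ _)) (y, a₀) :=
    HasFDerivAt.comp (y, a₀) (g := ψ) hψD hasFDerivAt_snd
  have d2 : HasFDerivAt (fun q : EuclideanSpace ℝ (Fin N) × EuclideanSpace ℝ (Fin d) => fderiv ℝ ψ q.2)
      (H.comp (ContinuousLinearMap.snd ℝ _ _)) (y, a₀) :=
    HasFDerivAt.comp (y, a₀) (g := fderiv ℝ ψ) hH hasFDerivAt_snd
  have d3 := (innR N).hasFDerivAt.comp (y, a₀) (hasFDerivAt_fst.sub d1)
  have dF := d3.clm_comp d2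
  have hform : ∀ p w w', fderiv ℝ Fn (y, a₀) (p, w) w' =
      inner ℝ (p - D w) (D w') + inner ℝ (y - ψ a₀) (H w w') := by
    intro p w w'
    have e : fderiv ℝ Fn (y, a₀) = _ := hFd.unique dF
    rw [e]
    simp [innR_apply, hψD.fderiv, inner_sub_left]
    ring
  have hinj : Function.Injective (fderiv ℝ Fn (y, a₀) ∘L .inr ℝ _ _) := by
    rw [injective_iff_map_eq_zero]
    intro w hw
    by_contra hne
    have h1 := congrArg (fun l => l w) hw
    simp only [ContinuousLinearMap.comp_apply, ContinuousLinearMap.inr_apply, hform] at h1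
    rw [zero_sub, inner_neg_left, real_inner_self_eq_norm_sq, hD] at h1
    have h2 := hpos w hne
    simp at h1
    linarith
  have hinv : (fderiv ℝ Fn (y, a₀) ∘L .inr ℝ _ _).IsInvertible := by
    have hfr : Module.finrank ℝ (EuclideanSpace ℝ (Fin d)) =
        Module.finrank ℝ (EuclideanSpace ℝ (Fin d) →L[ℝ] ℝ) := by
      rw [← (LinearMap.toContinuousLinearMap (𝕜 := ℝ) (E := EuclideanSpace ℝ (Fin d)) (F' := ℝ)).finrank_eq]
      exact (Subspace.dual_finrank_eq (K := ℝ) (V := EuclideanSpace ℝ (Fin d))).symm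
    refine ⟨(LinearEquiv.ofInjectiveOfFinrankEq
      (fderiv ℝ Fn (y, a₀) ∘L .inr ℝ _ _).toLinearMap hinj hfr).toContinuousLinearEquiv, ?_⟩
    ext1 w
    rfl
  have hn : (1 : WithTop ℕ∞) ≠ 0 := by norm_num
  have hF0 : Fn (y, a₀) = 0 := by
    have := hcrit.self_of_nhds
    rw [hgy] at this
    ext1 w
    exact this w
  have heq : cF.implicitFunction hn hinv =ᶠ[𝓝 y] g := by
    have ht : Tendsto (fun p => (p, g p)) (𝓝 y) (𝓝 (y, a₀)) := tendsto_id.prodMk_nhds hg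
    filter_upwards [ht.eventually (cF.eventually_apply_eq_iff_implicitFunction hn hinv), hcrit]
      with p h1 h2
    refine h1.1 ?_
    rw [hF0]
    ext1 w
    exact h2 w
  have hgC : ContDiffAt ℝ 1 g y := (cF.contDiffAt_implicitFunction hn hinv).congr_of_eventuallyEq heq.symm
  refine ⟨hgC, fun p w' => ?_⟩
  rw [← hform p (fderiv ℝ g y p) w']
  have hgd : HasFDerivAt g (fderiv ℝ g y) y := (hgC.differentiableAt (by norm_num)).hasFDerivAt
  have hpair : HasFDerivAt (fun p => (p, g p)) ((ContinuousLinearMap.id ℝ _).prod (fderiv ℝ g y)) y :=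
    (hasFDerivAt_id y).prodMk hgd
  have hFd' : HasFDerivAt Fn (fderiv ℝ Fn (y, a₀)) (y, g y) := by rw [hgy]; exact hFd
  have hc := HasFDerivAt.comp y hFd' hpair
  have hz : (Fn ∘ fun p => (p, g p)) =ᶠ[𝓝 y] fun _ => 0 := by
    filter_upwards [hcrit] with p h2
    ext1 w
    exact h2 w
  have h0 := (hc.congr_of_eventuallyEq hz.symm).unique (hasFDerivAt_const (0 : EuclideanSpace ℝ (Fin d) →L[ℝ] ℝ) y)
  have h3 := congrArg (fun l => l p w') h0
  simpa using h3

end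
section
open Filter Topology
variable {N d : ℕ}

theorem proj_local (M : Set (EuclideanSpace ℝ (Fin N))) (hMc : IsCompact M) (hMne : M.Nonempty)
    (R ρ : ℝ) (hu : ∀ p, Metric.infDist p M < R → HasUniqueNearest M p)
    (hρ0 : 0 < ρ) (hρR : ρ < R)
    (x : EuclideanSpace ℝ (Fin N)) (hx : x ∈ M)
    (D : EuclideanSpace ℝ (Fin d) →L[ℝ] EuclideanSpace ℝ (Fin N))
    (hD : ∀ w, ‖D w‖ = ‖w‖)
    (ψ : EuclideanSpace ℝ (Fin d) → EuclideanSpace ℝ (Fin N))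
    (hψC : ContDiffAt ℝ 2 ψ (ContinuousLinearMap.adjoint D x))
    (hψD : HasFDerivAt ψ D (ContinuousLinearMap.adjoint D x))
    (hψx : ψ (ContinuousLinearMap.adjoint D x) = x)
    (hψM : ∀ᶠ a in 𝓝 (ContinuousLinearMap.adjoint D x), ψ a ∈ M)
    (hgr : ∀ᶠ m in 𝓝[M] x, ψ (ContinuousLinearMap.adjoint D m) = m)
    (v : EuclideanSpace ℝ (Fin N)) (hv : ‖v‖ = 1) (hvD : ∀ w, inner ℝ v (D w) = 0)
    (τ : ℝ) (hτ0 : 0 ≤ τ) (hτρ : τ ≤ ρ) (y : EuclideanSpace ℝ (Fin N)) (hy : y = x + τ • v) :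
    ContDiffAt ℝ 1 (fun p => ContinuousLinearMap.adjoint D (nearestPt M p)) y ∧
    (∀ᶠ p in 𝓝 y, ψ (ContinuousLinearMap.adjoint D (nearestPt M p)) = nearestPt M p) ∧
    nearestPt M y = x ∧ ContinuousAt (nearestPt M) y ∧
    ∃ B : EuclideanSpace ℝ (Fin d) →ₗ[ℝ] EuclideanSpace ℝ (Fin d), B.IsSymmetric ∧
      (∀ w, (1 - ρ / R) * ‖w‖ ^ 2 ≤ inner ℝ (B w) w) ∧
      (∀ w, inner ℝ (B w) w ≤ (1 + ρ / R) * ‖w‖ ^ 2) ∧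
      ∀ p, B (fderiv ℝ (fun p => ContinuousLinearMap.adjoint D (nearestPt M p)) y p) =
        ContinuousLinearMap.adjoint D p := by
  set A := ContinuousLinearMap.adjoint D with hA
  have hRp : 0 < R := hρ0.trans hρR
  have hray : ∀ v' : EuclideanSpace ℝ (Fin N), ‖v'‖ = 1 → (∀ w, inner ℝ v' (D w) = 0) →
      ∀ t, 0 ≤ t → t < R → Metric.infDist (x + t • v') M = t := by
    intro v' hv' hvD' t h0 h1
    obtain ⟨t₀, ht₀, ht⟩ := small_ray M hMc x hx D hD ψ hψC hψD hψx hgr v' hv' hvD'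
    exact normal_ray M hMc hMne R hu x v' hx hv' t₀ ht₀ ht t h0 h1
  set H := fderiv ℝ (fderiv ℝ ψ) (A x) with hH
  have hcurv : ∀ v' : EuclideanSpace ℝ (Fin N), ‖v'‖ = 1 → (∀ w, inner ℝ v' (D w) = 0) →
      ∀ w, R * inner ℝ v' (H w w) ≤ ‖w‖ ^ 2 := by
    intro v' hv' hvD' w
    have hl : Tendsto (fun t : ℝ => t * inner ℝ v' (H w w)) (𝓝[<] R) (𝓝 (R * inner ℝ v' (H w w))) := by
      have : Continuous (fun t : ℝ => t * inner ℝ v' (H w w)) := by fun_prop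
      exact (this.tendsto R).mono_left nhdsWithin_le_nhds
    refine le_of_tendsto hl ?_
    filter_upwards [Ioo_mem_nhdsLT hRp] with t ht
    exact curvature_bound M x D hD ψ (A x) hψC hψD hψx hψM v' hv' t ht.1.le
      (hray v' hv' hvD' t ht.1.le ht.2) w
  have hτR : τ < R := hτρ.trans_lt hρR
  have hcv : ∀ w, |τ * inner ℝ v (H w w)| ≤ ρ / R * ‖w‖ ^ 2 := by
    intro w
    have h1 := hcurv v hv hvD w
    have h2 := hcurv (-v) (by rwa [norm_neg]) (fun w => by rw [inner_neg_left, hvD, neg_zero]) w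
    rw [inner_neg_left] at h2
    have h3 : |inner ℝ v (H w w)| ≤ ‖w‖ ^ 2 / R := by
      rw [abs_le]
      constructor
      · rw [neg_le, le_div_iff₀ hRp]; linarith
      · rw [le_div_iff₀ hRp]; linarith
    rw [abs_mul, abs_of_nonneg hτ0]
    calc τ * |inner ℝ v (H w w)| ≤ ρ * (‖w‖ ^ 2 / R) := by gcongr
      _ = ρ / R * ‖w‖ ^ 2 := by ring
  have hinf : Metric.infDist y M = τ := by rw [hy]; exact hray v hv hvD τ hτ0 hτR
  have huy : HasUniqueNearest M y := hu y (by rw [hinf]; exact hτR)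
  have hny : nearestPt M y = x := by
    refine huy.unique (nearestPt_spec M hMc hMne y) ⟨hx, ?_⟩
    rw [hinf, hy, dist_eq_norm]; simp [norm_smul, hv, abs_of_nonneg hτ0]
  have hcont := nearestPt_continuousAt M hMc hMne y huy
  have hnt : Tendsto (nearestPt M) (𝓝 y) (𝓝[M] x) := by
    refine tendsto_nhdsWithin_iff.2 ⟨?_, Eventually.of_forall fun p => (nearestPt_spec M hMc hMne p).1⟩
    have := hcont.tendsto
    rwa [hny] at this
  have hAt : Tendsto (fun p => A (nearestPt M p)) (𝓝 y) (𝓝 (A x)) :=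
    (A.continuous.tendsto x).comp (hnt.mono_right nhdsWithin_le_nhds)
  have hgr' := hnt.eventually hgr
  have hdiff : ∀ᶠ a in 𝓝 (A x), DifferentiableAt ℝ ψ a := by
    filter_upwards [hψC.eventually (by norm_num)] with a ha
    exact ha.differentiableAt (by norm_num)
  have hcrit : ∀ᶠ p in 𝓝 y, ∀ w, inner ℝ (p - ψ (A (nearestPt M p)))
      (fderiv ℝ ψ (A (nearestPt M p)) w) = 0 := by
    filter_upwards [hgr', hAt.eventually hdiff, hAt.eventually (eventually_eventually_nhds.2 hψM)]
      with p h1 h2 h3 w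
    have hmin : IsLocalMin (fun a => ‖p - ψ a‖ ^ 2) (A (nearestPt M p)) := by
      filter_upwards [h3] with a ha
      rw [h1, ← dist_eq_norm, ← dist_eq_norm, (nearestPt_spec M hMc hMne p).2]
      exact pow_le_pow_left₀ Metric.infDist_nonneg (Metric.infDist_le_dist_of_mem ha) 2
    have hd := (h2.hasFDerivAt.const_sub p).norm_sq
    have h0 := hmin.hasFDerivAt_eq_zero hd
    have h4 := congrArg (fun l => l w) h0
    simp at h4
    rw [inner_sub_left]
    linarith
  have hyx : y - ψ (A x) = τ • v := by rw [hψx, hy]; abel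
  have hrat : ρ / R < 1 := (div_lt_one hRp).2 hρR
  obtain ⟨hC1, hder⟩ := implicit_proj D hD ψ (A x) hψC hψD y (by
    intro w hw
    rw [hyx, real_inner_smul_left]
    have hwp : 0 < ‖w‖ ^ 2 := by positivity
    have := (le_abs_self _).trans (hcv w)
    change τ * inner ℝ v (H w w) < _
    nlinarith) (fun p => A (nearestPt M p)) hAt (by simp only [hny]) hcrit
  refine ⟨hC1, hgr', hny, hcont, ?_⟩
  have hsym : ∀ w w', H w w' = H w' w := fun w w' =>
    (hψC.isSymmSndFDerivAt (by simp)).eq w w'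
  let B : EuclideanSpace ℝ (Fin d) →ₗ[ℝ] EuclideanSpace ℝ (Fin d) :=
    { toFun := fun w => w - τ • ContinuousLinearMap.adjoint (H w) v
      map_add' := fun a b => by simp only [map_add, _root_.add_apply, smul_add]; abel
      map_smul' := fun c a => by simp [smul_sub, smul_comm c τ] }
  have hBi : ∀ w w', inner ℝ (B w) w' = inner ℝ w w' - τ * inner ℝ v (H w w') := by
    intro w w'
    change inner ℝ (w - τ • ContinuousLinearMap.adjoint (H w) v) w' = _
    rw [inner_sub_left, real_inner_smul_left, ContinuousLinearMap.adjoint_inner_left]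
  refine ⟨B, ?_, ?_, ?_, ?_⟩
  · intro w w'
    rw [hBi, real_inner_comm (B w') w, hBi, hsym w' w, real_inner_comm w' w]
  · intro w
    rw [hBi, real_inner_self_eq_norm_sq]
    have := (le_abs_self _).trans (hcv w)
    linarith
  · intro w
    rw [hBi, real_inner_self_eq_norm_sq]
    have := (neg_abs_le _).trans' (neg_le_neg (hcv w))
    linarith
  · intro p
    refine ext_inner_right ℝ fun w' => ?_
    rw [hBi, hA, ContinuousLinearMap.adjoint_inner_left]
    have h := hder p w'
    rw [hyx, real_inner_smul_left, inner_sub_left, inner_of_iso D hD] at h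
    linarith

end
/-- **Restriction of `π_M` to a `d`-flat: local diffeomorphism and Jacobian bounds.**
Let `M ⊆ ℝ^N` be a compact `C²` `d`-submanifold with reach `R`, `0 < ρ < R`,
`x ∈ M`, `v` a unit normal vector at `x`, `0 ≤ τ ≤ ρ`, and `Π` a `d`-dimensional
affine subspace through `y = x + τv` with `θ = ∠(Π, T_x M) < π/2`.  Then `π_M`
restricted to a small neighborhood of `y` in `Π` is a `C¹` diffeomorphism onto
its image in `M`; moreover, expressing `π_M` in normal coordinates (an orthonormal
parametrization `ι` of `Π` and a chart `ξ` of `M` at `x` whose derivative is an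
isometry onto `T_x M`), the absolute Jacobian determinant at `y` lies in
`[(R/(R+ρ))^d (cos θ)^{min(d, N-d)}, (R/(R-ρ))^d cos θ]`. -/
theorem projection_restricted_to_flat_jacobian
    {N d : ℕ} (M : Set (EuclideanSpace ℝ (Fin N)))
    (hM : IsC2Submanifold d M) (hMc : IsCompact M) (hMne : M.Nonempty)
    (R ρ : ℝ) (hRpos : 0 < R) (hreach : ENNReal.ofReal R = reach M)
    (hρ0 : 0 < ρ) (hρR : ρ < R)
    (x : EuclideanSpace ℝ (Fin N)) (hx : x ∈ M)
    (v : EuclideanSpace ℝ (Fin N)) (hv : ‖v‖ = 1) (hvN : v ∈ (tangentSpan M x)ᗮ)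
    (τ : ℝ) (hτ0 : 0 ≤ τ) (hτρ : τ ≤ ρ)
    (y : EuclideanSpace ℝ (Fin N)) (hy : y = x + τ • v)
    (Pl : AffineSubspace ℝ (EuclideanSpace ℝ (Fin N)))
    (hyPl : y ∈ Pl) (hPldim : Module.finrank ℝ Pl.direction = d)
    (hθ : subspaceAngle Pl.direction (tangentSpan M x) < Real.pi / 2)
    -- an orthonormal parametrization of `Π` centered at `y`:
    (ι : EuclideanSpace ℝ (Fin d) →ₗᵢ[ℝ] EuclideanSpace ℝ (Fin N))
    (hι : LinearMap.range ι.toLinearMap = Pl.direction)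
    -- a chart of `M` at `x` in normal coordinates (derivative an isometry onto `T_x M`):
    (U₀ : Set (EuclideanSpace ℝ (Fin d))) (hU₀ : IsOpen U₀)
    (ξ : EuclideanSpace ℝ (Fin d) → EuclideanSpace ℝ (Fin N))
    (u₀ : EuclideanSpace ℝ (Fin d)) (hu₀ : u₀ ∈ U₀) (hξx : ξ u₀ = x)
    (hξC2 : ContDiffOn ℝ 2 ξ U₀) (hξinj : Set.InjOn ξ U₀) (hξM : ξ '' U₀ ⊆ M)
    (hξiso : ∀ w, ‖fderivWithin ℝ ξ U₀ u₀ w‖ = ‖w‖)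
    (hξtan : Set.range (fderivWithin ℝ ξ U₀ u₀) = (tangentSpan M x : Set (EuclideanSpace ℝ (Fin N)))) :
    (∃ U : Set (EuclideanSpace ℝ (Fin N)), y ∈ U ∧ IsOpen U ∧
      Set.InjOn (nearestPt M) (U ∩ Pl) ∧
      ContDiffOn ℝ 1 (nearestPt M) (U ∩ Pl) ∧
      nearestPt M '' (U ∩ Pl) ⊆ M ∧
      ContDiffOn ℝ 1 (Function.invFunOn (nearestPt M) (U ∩ Pl)) (nearestPt M '' (U ∩ Pl))) ∧
    |LinearMap.det
        ((fderiv ℝ (fun z : EuclideanSpace ℝ (Fin d) =>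
            Function.invFunOn ξ U₀ (nearestPt M (y + ι z))) 0).toLinearMap)| ∈
      Set.Icc
        ((R / (R + ρ)) ^ d * Real.cos (subspaceAngle Pl.direction (tangentSpan M x)) ^ min d (N - d))
        ((R / (R - ρ)) ^ d * Real.cos (subspaceAngle Pl.direction (tangentSpan M x))) := by
  have hu := uniq_of_reach M R hreach
  obtain ⟨D, ψ, k, hD, hDr, hψC, hψD, hψx, hψM, hgr, hk, hkev⟩ :=
    graph_chart M hM x hx U₀ hU₀ ξ u₀ hu₀ hξx hξC2 hξinj hξM hξiso hξtan
  have hvD : ∀ w, inner ℝ v (D w) = 0 := by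
    intro w
    have hmem : D w ∈ tangentSpan M x := by
      have : D w ∈ Set.range D := ⟨w, rfl⟩
      rw [hDr] at this
      exact this
    exact (Submodule.mem_orthogonal' _ _).1 hvN _ hmem
  obtain ⟨hC1, hgr', hny, hcont, B, hBs, hB1, hB2, hBder⟩ :=
    proj_local M hMc hMne R ρ hu hρ0 hρR x hx D hD ψ hψC hψD hψx hψM hgr v hv hvD τ hτ0 hτρ y hy
  obtain ⟨hP1, hP2⟩ := det_proj_bounds D hD (tangentSpan M x) hDr ι Pl.direction hι
  set A := ContinuousLinearMap.adjoint D with hA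
  set θ := subspaceAngle Pl.direction (tangentSpan M x) with hθdef
  set g : EuclideanSpace ℝ (Fin N) → EuclideanSpace ℝ (Fin d) := fun p => A (nearestPt M p) with hg
  have hrat : ρ / R < 1 := (div_lt_one hRpos).2 hρR
  obtain ⟨hb1, hb2⟩ := det_symm_bounds B hBs (1 - ρ / R) (1 + ρ / R) (by linarith) hB1 hB2
  have hdetB : 0 < LinearMap.det B := lt_of_lt_of_le (pow_pos (by linarith) d) hb1
  let ιL : EuclideanSpace ℝ (Fin d) →L[ℝ] EuclideanSpace ℝ (Fin N) := ι.toContinuousLinearMap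
  have hιL : ∀ w, ‖ιL w‖ = ‖w‖ := fun w => ι.norm_map w
  have haff : HasFDerivAt (fun z : EuclideanSpace ℝ (Fin d) => y + ι z) ιL 0 :=
    ιL.hasFDerivAt.const_add y
  have haffC : ContDiff ℝ 1 (fun z : EuclideanSpace ℝ (Fin d) => y + ι z) :=
    contDiff_const.add ιL.contDiff
  have h00 : y + ι 0 = y := by simp
  have hgd : HasFDerivAt g (fderiv ℝ g y) (y + ι 0) := by
    rw [h00]; exact (hC1.differentiableAt (by norm_num)).hasFDerivAt
  have hC1' : ContDiffAt ℝ 1 g (y + ι 0) := by rw [h00]; exact hC1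
  set G : EuclideanSpace ℝ (Fin d) → EuclideanSpace ℝ (Fin d) := fun z => g (y + ι z) with hG
  set G' : EuclideanSpace ℝ (Fin d) →L[ℝ] EuclideanSpace ℝ (Fin d) := (fderiv ℝ g y).comp ιL with hG'
  have hGd : HasFDerivAt G G' 0 := HasFDerivAt.comp (g := g) (0 : EuclideanSpace ℝ (Fin d)) hgd haff
  have hGC : ContDiffAt ℝ 1 G 0 :=
    ContDiffAt.comp (g := g) (0 : EuclideanSpace ℝ (Fin d)) hC1' haffC.contDiffAt
  have hG0 : G 0 = A x := by simp only [hG, hg, h00, hny]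
  have hdet : LinearMap.det B * LinearMap.det G'.toLinearMap =
      LinearMap.det (A.toLinearMap ∘ₗ ι.toLinearMap) := by
    rw [← LinearMap.det_comp]
    congr 1
    ext1 z
    exact hBder (ι z)
  have habs : LinearMap.det B * |LinearMap.det G'.toLinearMap| =
      |LinearMap.det (A.toLinearMap ∘ₗ ι.toLinearMap)| := by
    rw [← hdet, abs_mul, abs_of_pos hdetB]
  have hcos : 0 < Real.cos θ ^ min d (N - d) := by
    rcases Nat.eq_zero_or_pos d with h | h
    · rw [h]; simp
    · obtain ⟨h0, -, -⟩ := cos_angle_bounds D hD (tangentSpan M x) hDr h ι Pl.direction hι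
      exact pow_pos (Real.cos_pos_of_mem_Ioo ⟨by linarith [Real.pi_pos], hθ⟩) _
  have hcos1 : 0 ≤ Real.cos θ := (abs_nonneg _).trans hP2
  have hdetG : LinearMap.det G'.toLinearMap ≠ 0 := by
    intro h0
    rw [h0] at habs
    simp only [abs_zero, mul_zero] at habs
    linarith
  have hnt : Filter.Tendsto (nearestPt M) (nhds y) (nhdsWithin x M) := by
    refine tendsto_nhdsWithin_iff.2
      ⟨?_, Filter.Eventually.of_forall fun p => (nearestPt_spec M hMc hMne p).1⟩
    have := hcont.tendsto
    rwa [hny] at this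
  have hgt : Filter.Tendsto g (nhds y) (nhds (A x)) :=
    (A.continuous.tendsto x).comp (hnt.mono_right nhdsWithin_le_nhds)
  constructor
  · let e : EuclideanSpace ℝ (Fin d) ≃L[ℝ] EuclideanSpace ℝ (Fin d) :=
      (LinearMap.equivOfDetNeZero G'.toLinearMap hdetG).toContinuousLinearEquiv
    have hGe : HasFDerivAt G (e : EuclideanSpace ℝ (Fin d) →L[ℝ] EuclideanSpace ℝ (Fin d)) 0 := by
      refine hGd.congr_fderiv ?_
      ext1 z
      rfl
    have hn : (1 : WithTop ℕ∞) ≠ 0 := by norm_num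
    set Hinv := hGC.localInverse hGe hn with hHinv
    have hHC : ContDiffAt ℝ 1 Hinv (A x) := by
      rw [← hG0]; exact hGC.to_localInverse hGe hn
    have hleft : ∀ᶠ z in nhds (0 : EuclideanSpace ℝ (Fin d)), Hinv (G z) = z :=
      (hGC.hasStrictFDerivAt' hGe hn).eventually_left_inverse
    set ιA := ContinuousLinearMap.adjoint ιL with hιA
    have hzt : Filter.Tendsto (fun p => ιA (p - y)) (nhds y) (nhds 0) := by
      have : Continuous (fun p => ιA (p - y)) := by fun_prop
      simpa using this.tendsto y
    have hall := (hC1.eventually (by norm_num)).and <| (eventually_eventually_nhds.2 hgr').and <|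
      (hgt.eventually ((hψC.of_le (m := 1) (by norm_num)).eventually (by norm_num))).and <|
      (hgt.eventually (hHC.eventually (by norm_num))).and (hzt.eventually hleft)
    obtain ⟨U, hU, hUo, hyU⟩ := _root_.eventually_nhds_iff.1 hall
    have hrec : ∀ p ∈ U ∩ (Pl : Set (EuclideanSpace ℝ (Fin N))),
        y + ι (Hinv (A (nearestPt M p))) = p := by
      rintro p ⟨hpU, hpP⟩
      obtain ⟨-, -, -, -, h5⟩ := hU p hpU
      have hdir : p - y ∈ Pl.direction := AffineSubspace.vsub_mem_direction hpP hyPl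
      rw [← hι] at hdir
      obtain ⟨z, hz⟩ := hdir
      have hz' : ι z = p - y := hz
      have hz2 : ιA (p - y) = z := by
        rw [← hz']; exact adj_left ιL hιL z
      rw [hz2] at h5
      have hp : y + ι z = p := by rw [hz']; abel
      have h6 : G z = A (nearestPt M p) := by simp only [hG, hg, hp]
      rw [← h6, h5, hp]
    have hinj : Set.InjOn (nearestPt M) (U ∩ Pl) := by
      intro p hp q hq hpq
      rw [← hrec p hp, ← hrec q hq, hpq]
    refine ⟨U, hyU, hUo, hinj, ?_, ?_, ?_⟩
    · rintro p ⟨hpU, -⟩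
      obtain ⟨h1, h2, h3, -, -⟩ := hU p hpU
      have hc : ContDiffAt ℝ 1 (fun q => ψ (g q)) p := ContDiffAt.comp (g := ψ) p h3 h1
      exact (hc.congr_of_eventuallyEq (h2.mono fun q hq => hq.symm)).contDiffWithinAt
    · rintro _ ⟨p, -, rfl⟩
      exact (nearestPt_spec M hMc hMne p).1
    · have hΦ : ContDiffOn ℝ 1 (fun m => y + ι (Hinv (A m))) (nearestPt M '' (U ∩ Pl)) := by
        rintro _ ⟨p, ⟨hpU, -⟩, rfl⟩
        obtain ⟨-, -, -, h4, -⟩ := hU p hpU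
        have h5 : ContDiffAt ℝ 1 (fun m => Hinv (A m)) (nearestPt M p) :=
          ContDiffAt.comp (g := Hinv) (nearestPt M p) h4 A.contDiff.contDiffAt
        have h6 : ContDiffAt ℝ 1 (fun m => y + ι (Hinv (A m))) (nearestPt M p) :=
          ContDiffAt.comp (g := fun z => y + ι z) (nearestPt M p) haffC.contDiffAt h5
        exact h6.contDiffWithinAt
      refine hΦ.congr ?_
      rintro _ ⟨p, hp, rfl⟩
      rw [hrec p hp]
      exact hinj.leftInvOn_invFunOn hp
  · have haft : Filter.Tendsto (fun z : EuclideanSpace ℝ (Fin d) => y + ι z) (nhds 0) (nhds y) := by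
      have := haffC.continuous.tendsto 0
      rwa [h00] at this
    have hev : (fun z : EuclideanSpace ℝ (Fin d) =>
        Function.invFunOn ξ U₀ (nearestPt M (y + ι z))) =ᶠ[nhds 0] fun z => k (G z) :=
      (hnt.comp haft).eventually hkev
    have hk' : HasFDerivAt k (ContinuousLinearMap.id ℝ (EuclideanSpace ℝ (Fin d))) (G 0) := by
      rw [hG0]; exact hk
    have hkG : HasFDerivAt (fun z => k (G z))
        ((ContinuousLinearMap.id ℝ (EuclideanSpace ℝ (Fin d))).comp G') 0 :=
      HasFDerivAt.comp (0 : EuclideanSpace ℝ (Fin d)) hk' hGd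
    rw [(hkG.congr_of_eventuallyEq hev).fderiv, ContinuousLinearMap.id_comp]
    have e1 : R / (R + ρ) = (1 + ρ / R)⁻¹ := by
      field_simp
    have hRρ : 0 < R - ρ := by linarith
    have e2 : R / (R - ρ) = (1 - ρ / R)⁻¹ := by
      refine eq_inv_of_mul_eq_one_left ?_
      have h1 := hRpos.ne'
      have h2 := hRρ.ne'
      field_simp
    have hlo : 0 < (1 - ρ / R) ^ d := pow_pos (by linarith) d
    have hhi : 0 < (1 + ρ / R) ^ d := by positivity
    have hval : |LinearMap.det G'.toLinearMap| =
        (LinearMap.det B)⁻¹ * |LinearMap.det (A.toLinearMap ∘ₗ ι.toLinearMap)| := by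
      rw [← habs, inv_mul_cancel_left₀ hdetB.ne']
    rw [hval, e1, e2, inv_pow, inv_pow]
    constructor
    · exact mul_le_mul ((inv_le_inv₀ hhi hdetB).2 hb2) hP1 hcos.le (inv_nonneg.2 hdetB.le)
    · exact mul_le_mul ((inv_le_inv₀ hdetB hlo).2 hb1) hP2 (abs_nonneg _) (inv_nonneg.2 hlo.le)
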